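/- arXiv:0807.0367 — 2 statements merged into one kernel-verified Lean document; each statement's English description precedes it below -/
import Mathlib

section
/- Quadratic Morawetz identity for the Hartree equation: let h : ℝⁿ → ℝ be a smooth even function all of whose derivatives of order ≥ 1 are bounded, let V : ℝⁿ → ℝ be a smooth real even function with all derivatives bounded, and let u be a smooth decaying solution of the Hartree equation. Then M(t) is differentiable in t and M'(t) = (1/2)⟨∇ρ(t), Δh ⋆ ∇ρ(t)⟩ + ∫∫ ρ(t,x) ∇h(x-y)·( ρ ∇(V⋆ρ) )(t,y) dx dy + R(t), where R(t) = (1/2)∫∫ Σ_{k,l=1}^n ∂_k∂_l h(x-y) · conj(w_k(x,y)) · w_l(x,y) dx dy with w(x,y) = u(t,x)∇u(t,y) - u(t,y)∇u(t,x) ∈ ℂⁿ. -/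
open MeasureTheory Filter Complex

noncomputable section

/-- `ℝⁿ` as a Euclidean space. -/
abbrev Ed (n : ℕ) := EuclideanSpace ℝ (Fin n)

/-- Spatial partial derivative `∂_k` of a complex-valued function. -/
def pd {n : ℕ} (k : Fin n) (f : Ed n → ℂ) (x : Ed n) : ℂ :=
  fderiv ℝ f x (EuclideanSpace.single k 1)

/-- Spatial partial derivative `∂_k` of a real-valued function. -/
def pdR {n : ℕ} (k : Fin n) (f : Ed n → ℝ) (x : Ed n) : ℝ :=
  fderiv ℝ f x (EuclideanSpace.single k 1)

/-- Spatial Laplacian of a complex-valued function. -/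
def lapC {n : ℕ} (f : Ed n → ℂ) (x : Ed n) : ℂ := ∑ k, pd k (fun y => pd k f y) x

/-- Spatial Laplacian of a real-valued function. -/
def lapR {n : ℕ} (f : Ed n → ℝ) (x : Ed n) : ℝ := ∑ k, pdR k (fun y => pdR k f y) x

/-- Second partial derivative `∂_k ∂_l h`. -/
def hess {n : ℕ} (h : Ed n → ℝ) (k l : Fin n) (x : Ed n) : ℝ :=
  pdR k (fun y => pdR l h y) x

/-- `u(t,·)` and all its space-time derivatives are Schwartz in `x`,
uniformly for `t` in compact intervals. -/
def SchwartzDecay {n : ℕ} (u : ℝ → Ed n → ℂ) : Prop :=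
  ∀ (N m : ℕ) (a b : ℝ), ∃ C : ℝ, ∀ t ∈ Set.Icc a b, ∀ x : Ed n,
    (1 + ‖x‖) ^ m * ‖iteratedFDeriv ℝ N (fun p : ℝ × Ed n => u p.1 p.2) (t, x)‖ ≤ C

/-- A smooth decaying solution of the NLS equation `i ∂_t u = -(1/2) Δu + g(|u|²) u`. -/
def IsNLSSolution {n : ℕ} (g : ℝ → ℝ) (u : ℝ → Ed n → ℂ) : Prop :=
  ContDiff ℝ (⊤ : ℕ∞) (fun p : ℝ × Ed n => u p.1 p.2) ∧ SchwartzDecay u ∧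
    ∀ t x, Complex.I * deriv (fun s => u s x) t =
      -(1/2) * lapC (u t) x + ((g (‖u t x‖ ^ 2) : ℝ) : ℂ) * u t x

/-- Mass density `ρ = |u|²`. -/
def dens {n : ℕ} (u : ℝ → Ed n → ℂ) (t : ℝ) (x : Ed n) : ℝ := ‖u t x‖ ^ 2

/-- Mass current `j = Im (ū ∇u)`, `k`-th component. -/
def curr {n : ℕ} (u : ℝ → Ed n → ℂ) (k : Fin n) (t : ℝ) (x : Ed n) : ℝ :=
  ((starRingEnd ℂ) (u t x) * pd k (u t) x).im

/-- A smooth decaying solution of the Hartree equation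
`i ∂_t u = -(1/2) Δu + (V ⋆ |u|²) u`. -/
def IsHartreeSolution {n : ℕ} (V : Ed n → ℝ) (u : ℝ → Ed n → ℂ) : Prop :=
  ContDiff ℝ (⊤ : ℕ∞) (fun p : ℝ × Ed n => u p.1 p.2) ∧ SchwartzDecay u ∧
    ∀ t x, Complex.I * deriv (fun s => u s x) t =
      -(1/2) * lapC (u t) x + (((∫ y, V (x - y) * ‖u t y‖ ^ 2) : ℝ) : ℂ) * u t x

/-- The Morawetz quantity `M(t) = -⟨ρ(t), ∇h ⋆ j(t)⟩`. -/
def morawetzM {n : ℕ} (h : Ed n → ℝ) (u : ℝ → Ed n → ℂ) (t : ℝ) : ℝ :=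
  -∫ x, ∫ y, dens u t x * ∑ k, pdR k h (x - y) * curr u k t y

/-- The commutator vector `w(x,y) = u(t,x)∇u(t,y) - u(t,y)∇u(t,x)`, `k`-th component. -/
def wVec {n : ℕ} (u : ℝ → Ed n → ℂ) (t : ℝ) (x y : Ed n) (k : Fin n) : ℂ :=
  u t x * pd k (u t) y - u t y * pd k (u t) x

/-- The remainder `R(t) = (1/2)∫∫ ∑_{k,l} ∂_k∂_l h(x-y) conj(w_k) w_l dx dy`. -/
def morawetzR {n : ℕ} (h : Ed n → ℝ) (u : ℝ → Ed n → ℂ) (t : ℝ) : ℝ :=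
  (1/2) * ∫ x, ∫ y,
    (∑ k, ∑ l, (hess h k l (x - y) : ℂ) *
      ((starRingEnd ℂ) (wVec u t x y k) * wVec u t x y l)).re

/-- Space-time functions that are smooth and, together with all their space-time derivatives,
rapidly decaying in space, locally uniformly in time. -/
structure RapidDecay {n : ℕ} {F : Type*} [NormedAddCommGroup F] [NormedSpace ℝ F]
    (A : ℝ × Ed n → F) : Prop where
  smooth : ContDiff ℝ (⊤ : ℕ∞) A
  decay : ∀ (N m : ℕ) (a b : ℝ), ∃ C : ℝ, ∀ t ∈ Set.Icc a b, ∀ x : Ed n,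
    (1 + ‖x‖) ^ m * ‖iteratedFDeriv ℝ N A (t, x)‖ ≤ C

/-- Directional derivative along `v`. -/
def dirD {E F : Type*} [NormedAddCommGroup E] [NormedSpace ℝ E] [NormedAddCommGroup F]
    [NormedSpace ℝ F] (v : E) (A : E → F) (p : E) : F := fderiv ℝ A p v

/-- The space-time vector pointing in the `k`-th spatial direction. -/
abbrev spaceDir {n : ℕ} (k : Fin n) : ℝ × Ed n := (0, EuclideanSpace.single k 1)

/-- The space-time vector pointing in the time direction. -/
abbrev timeDir (n : ℕ) : ℝ × Ed n := (1, 0)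

section DirectionalDerivative

variable {E F G : Type*} [NormedAddCommGroup E] [NormedSpace ℝ E] [NormedAddCommGroup F]
  [NormedSpace ℝ F] [NormedAddCommGroup G] [NormedSpace ℝ G]

theorem contDiff_dirD {A : E → F} (hA : ContDiff ℝ (⊤ : ℕ∞) A) (v : E) :
    ContDiff ℝ (⊤ : ℕ∞) (dirD v A) :=
  (hA.fderiv_right (m := (⊤ : ℕ∞)) (by simp)).clm_apply contDiff_const

theorem norm_iteratedFDeriv_dirD_le {A : E → F} (hA : ContDiff ℝ (⊤ : ℕ∞) A) (v : E) (N : ℕ)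
    (p : E) : ‖iteratedFDeriv ℝ N (dirD v A) p‖ ≤ ‖v‖ * ‖iteratedFDeriv ℝ (N + 1) A p‖ := by
  have h1 : ContDiff ℝ (⊤ : ℕ∞) (fderiv ℝ A) := hA.fderiv_right (by simp)
  have h2 := (ContinuousLinearMap.apply ℝ F v).norm_iteratedFDeriv_comp_left
    (h1.contDiffAt (x := p)) (n := N) (by exact_mod_cast le_top)
  rw [norm_iteratedFDeriv_fderiv] at h2
  refine h2.trans (mul_le_mul_of_nonneg_right ?_ (norm_nonneg _))
  exact ContinuousLinearMap.opNorm_le_bound _ (norm_nonneg _) fun L => by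
    simpa [mul_comm] using L.le_opNorm v

theorem dirD_comm {A : E → F} (hA : ContDiff ℝ (⊤ : ℕ∞) A) (v w : E) :
    dirD v (dirD w A) = dirD w (dirD v A) := by
  funext p
  have h1 : ContDiff ℝ (⊤ : ℕ∞) (fderiv ℝ A) := hA.fderiv_right (by simp)
  have hd : DifferentiableAt ℝ (fderiv ℝ A) p := h1.differentiable (by simp) p
  have key : ∀ v w : E, dirD v (dirD w A) p = fderiv ℝ (fderiv ℝ A) p v w := fun v w => by
    change fderiv ℝ (fun q => fderiv ℝ A q w) p v = _
    rw [fderiv_clm_apply hd (differentiableAt_const w)]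
    simp
  rw [key, key]
  exact hA.contDiffAt.isSymmSndFDerivAt 
    (by simpa using (show ((2 : ℕ∞) : WithTop ℕ∞) ≤ _ from by exact_mod_cast le_top)) v w

theorem dirD_clm (L : F →L[ℝ] G) {A : E → F} (hA : Differentiable ℝ A) (v : E) :
    dirD v (fun p => L (A p)) = fun p => L (dirD v A p) := by
  funext p
  exact DFunLike.congr_fun (L.hasFDerivAt.comp p (hA p).hasFDerivAt).fderiv v

theorem dirD_mul {A B : E → ℂ} (hA : Differentiable ℝ A) (hB : Differentiable ℝ B) (v : E) :
    dirD v (fun p => A p * B p) = fun p => A p * dirD v B p + dirD v A p * B p := by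
  funext p
  simp only [dirD]
  rw [HasFDerivAt.fderiv ((hA p).hasFDerivAt.fun_mul (hB p).hasFDerivAt)]
  simp [mul_comm]

theorem dirD_sum {ι : Type*} (s : Finset ι) {A : ι → E → F} (hA : ∀ i, Differentiable ℝ (A i))
    (v : E) : dirD v (fun p => ∑ i ∈ s, A i p) = fun p => ∑ i ∈ s, dirD v (A i) p := by
  funext p
  simp only [dirD]
  rw [HasFDerivAt.fderiv (HasFDerivAt.fun_sum fun i _ => (hA i p).hasFDerivAt)]
  simp

theorem dirD_add {A B : E → F} (hA : Differentiable ℝ A) (hB : Differentiable ℝ B) (v : E) :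
    dirD v (fun p => A p + B p) = fun p => dirD v A p + dirD v B p := by
  funext p
  simp only [dirD]
  rw [HasFDerivAt.fderiv ((hA p).hasFDerivAt.fun_add (hB p).hasFDerivAt)]
  simp

theorem hasDerivAt_slice_time {A : ℝ × E → F} (hA : Differentiable ℝ A) (t : ℝ) (x : E) :
    HasDerivAt (fun s => A (s, x)) (dirD (1, 0) A (t, x)) t := by
  have h1 : HasFDerivAt A (fderiv ℝ A (t, x)) (t, x) := (hA _).hasFDerivAt
  exact h1.comp_hasDerivAt t ((hasDerivAt_id t).prodMk (hasDerivAt_const t x))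

theorem hasFDerivAt_slice_space {A : ℝ × E → F} (hA : Differentiable ℝ A) (t : ℝ) (x : E) :
    HasFDerivAt (fun y => A (t, y))
      ((fderiv ℝ A (t, x)).comp (ContinuousLinearMap.inr ℝ ℝ E)) x :=
  (hA (t, x)).hasFDerivAt.comp x (hasFDerivAt_prodMk_right t x)

theorem fderiv_slice_space {A : ℝ × E → F} (hA : Differentiable ℝ A) (t : ℝ) (x v : E) :
    fderiv ℝ (fun y => A (t, y)) x v = dirD (0, v) A (t, x) := by
  rw [(hasFDerivAt_slice_space hA t x).fderiv]
  simp [dirD]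

end DirectionalDerivative

namespace RapidDecay

variable {n : ℕ} {F G : Type*} [NormedAddCommGroup F] [NormedSpace ℝ F] [NormedAddCommGroup G]
  [NormedSpace ℝ G]

theorem differentiable {A : ℝ × Ed n → F} (hA : RapidDecay A) : Differentiable ℝ A :=
  hA.smooth.differentiable (by simp)

theorem continuous {A : ℝ × Ed n → F} (hA : RapidDecay A) : Continuous A := hA.smooth.continuous

protected theorem dirD {A : ℝ × Ed n → F} (hA : RapidDecay A) (v : ℝ × Ed n) : RapidDecay (dirD v A) where
  smooth := contDiff_dirD hA.smooth v
  decay N m a b := by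
    obtain ⟨C, hC⟩ := hA.decay (N + 1) m a b
    refine ⟨‖v‖ * C, fun t ht x => ?_⟩
    calc _ ≤ (1 + ‖x‖) ^ m * (‖v‖ * ‖iteratedFDeriv ℝ (N + 1) A (t, x)‖) := by
          gcongr; exact norm_iteratedFDeriv_dirD_le hA.smooth v N _
      _ = ‖v‖ * ((1 + ‖x‖) ^ m * ‖iteratedFDeriv ℝ (N + 1) A (t, x)‖) := by ring
      _ ≤ _ := by gcongr; exact hC t ht x

theorem clm_comp {A : ℝ × Ed n → F} (hA : RapidDecay A) (L : F →L[ℝ] G) :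
    RapidDecay (fun p => L (A p)) where
  smooth := L.contDiff.comp hA.smooth
  decay N m a b := by
    obtain ⟨C, hC⟩ := hA.decay N m a b
    refine ⟨‖L‖ * C, fun t ht x => ?_⟩
    calc _ ≤ (1 + ‖x‖) ^ m * (‖L‖ * ‖iteratedFDeriv ℝ N A (t, x)‖) := by
          gcongr
          exact L.norm_iteratedFDeriv_comp_left hA.smooth.contDiffAt (by exact_mod_cast le_top)
      _ = ‖L‖ * ((1 + ‖x‖) ^ m * ‖iteratedFDeriv ℝ N A (t, x)‖) := by ring
      _ ≤ _ := by gcongr; exact hC t ht x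

theorem mul {A B : ℝ × Ed n → ℂ} (hA : RapidDecay A) (hB : RapidDecay B) :
    RapidDecay (fun p => A p * B p) where
  smooth := hA.smooth.mul hB.smooth
  decay N m a b := by
    choose C hC using fun i => hA.decay i m a b
    choose C' hC' using fun i => hB.decay i 0 a b
    refine ⟨∑ i ∈ Finset.range (N + 1), (N.choose i : ℝ) * C i * C' (N - i), fun t ht x => ?_⟩
    calc _ ≤ (1 + ‖x‖) ^ m * ∑ i ∈ Finset.range (N + 1), (N.choose i : ℝ) *
            ‖iteratedFDeriv ℝ i A (t, x)‖ * ‖iteratedFDeriv ℝ (N - i) B (t, x)‖ := by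
          gcongr
          exact norm_iteratedFDeriv_mul_le hA.smooth hB.smooth _ (by exact_mod_cast le_top)
      _ ≤ _ := by
          rw [Finset.mul_sum]
          refine Finset.sum_le_sum fun i _ => ?_
          have h1 := hC i t ht x
          have h2 := hC' (N - i) t ht x
          rw [pow_zero, one_mul] at h2
          have h0 : 0 ≤ (1 + ‖x‖) ^ m * ‖iteratedFDeriv ℝ i A (t, x)‖ := by positivity
          calc _ = (N.choose i : ℝ) * ((1 + ‖x‖) ^ m * ‖iteratedFDeriv ℝ i A (t, x)‖) *
                  ‖iteratedFDeriv ℝ (N - i) B (t, x)‖ := by ring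
            _ ≤ (N.choose i : ℝ) * C i * C' (N - i) := by
              have := h0.trans h1
              gcongr

/-- An integrable envelope that is uniform for times in a compact interval. -/
theorem exists_bound {A : ℝ × Ed n → F} (hA : RapidDecay A) (a b : ℝ) :
    ∃ g : Ed n → ℝ, Integrable g ∧ (∀ x, 0 ≤ g x) ∧
      ∀ t ∈ Set.Icc a b, ∀ x, ‖A (t, x)‖ ≤ g x := by
  obtain ⟨C, hC⟩ := hA.decay 0 (n + 1) a b
  have hint : Integrable (fun x : Ed n => (1 + ‖x‖) ^ (-((n : ℝ) + 1))) :=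
    integrable_one_add_norm (by simp)
  refine ⟨fun x => |C| * (1 + ‖x‖) ^ (-((n : ℝ) + 1)), hint.const_mul _,
    fun x => by positivity, fun t ht x => ?_⟩
  have h := (hC t ht x).trans (le_abs_self C)
  rw [norm_iteratedFDeriv_zero] at h
  have hpos : (0 : ℝ) < (1 + ‖x‖) ^ (n + 1) := by positivity
  have : (1 + ‖x‖) ^ (-((n : ℝ) + 1)) = ((1 + ‖x‖) ^ (n + 1))⁻¹ := by
    rw [Real.rpow_neg (by positivity)]; norm_cast
  simp only [this]
  rw [← div_eq_mul_inv, le_div_iff₀ hpos]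
  linarith

theorem continuous_slice {A : ℝ × Ed n → F} (hA : RapidDecay A) (t : ℝ) :
    Continuous fun x => A (t, x) := hA.continuous.comp (by fun_prop)

theorem integrable {A : ℝ × Ed n → F} (hA : RapidDecay A) (t : ℝ) :
    Integrable fun x => A (t, x) := by
  obtain ⟨g, hg, -, hAg⟩ := hA.exists_bound t t
  exact hg.mono' (hA.continuous_slice t).aestronglyMeasurable
    (.of_forall fun x => hAg t ⟨le_rfl, le_rfl⟩ x)

end RapidDecay

/-- Smooth functions all of whose derivatives are bounded. -/
structure BddSmooth {n : ℕ} (K : Ed n → ℝ) : Prop where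
  smooth : ContDiff ℝ (⊤ : ℕ∞) K
  bdd : ∀ i : ℕ, ∃ C : ℝ, ∀ x, ‖iteratedFDeriv ℝ i K x‖ ≤ C

theorem bddSmooth_dirD {n : ℕ} {K : Ed n → ℝ} (hK : ContDiff ℝ (⊤ : ℕ∞) K)
    (hbdd : ∀ i : ℕ, 1 ≤ i → ∃ C : ℝ, ∀ x, ‖iteratedFDeriv ℝ i K x‖ ≤ C) (v : Ed n) :
    BddSmooth (dirD v K) where
  smooth := contDiff_dirD hK v
  bdd i := by
    obtain ⟨C, hC⟩ := hbdd (i + 1) (by omega)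
    refine ⟨‖v‖ * C, fun x => (norm_iteratedFDeriv_dirD_le hK v i x).trans ?_⟩
    gcongr; exact hC x

namespace BddSmooth

variable {n : ℕ}

protected theorem dirD {K : Ed n → ℝ} (hK : BddSmooth K) (v : Ed n) : BddSmooth (dirD v K) :=
  bddSmooth_dirD hK.smooth (fun i _ => hK.bdd i) v

theorem differentiable {K : Ed n → ℝ} (hK : BddSmooth K) : Differentiable ℝ K :=
  hK.smooth.differentiable (by simp)

theorem exists_bound {K : Ed n → ℝ} (hK : BddSmooth K) : ∃ C : ℝ, 0 ≤ C ∧ ∀ x, ‖K x‖ ≤ C := by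
  obtain ⟨C, hC⟩ := hK.bdd 0
  refine ⟨C, (norm_nonneg _).trans (hC 0), fun x => ?_⟩
  simpa only [norm_iteratedFDeriv_zero] using hC x

theorem exists_fderiv_bound {K : Ed n → ℝ} (hK : BddSmooth K) :
    ∃ C : ℝ, 0 ≤ C ∧ ∀ x, ‖fderiv ℝ K x‖ ≤ C := by
  obtain ⟨C, hC⟩ := hK.bdd 1
  refine ⟨C, (norm_nonneg _).trans (hC 0), fun x => ?_⟩
  simpa only [norm_iteratedFDeriv_one] using hC x

end BddSmooth

/-- The double integral `∬ a(x) b(y) K(x - y) dx dy`. -/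
def pairing {n : ℕ} (K a b : Ed n → ℝ) : ℝ := ∫ x, ∫ y, a x * b y * K (x - y)

/-- `f` is integrable on the product space and has iterated integral `c`. -/
def HasDoubleIntegral {n : ℕ} (f : Ed n → Ed n → ℝ) (c : ℝ) : Prop :=
  Integrable (fun p : Ed n × Ed n => f p.1 p.2) ∧ ∫ x, ∫ y, f x y = c

namespace HasDoubleIntegral

variable {n : ℕ} {f g : Ed n → Ed n → ℝ} {c d : ℝ}

theorem integral_integral_eq (hf : Integrable (fun p : Ed n × Ed n => f p.1 p.2)) :
    ∫ x, ∫ y, f x y = ∫ p : Ed n × Ed n, f p.1 p.2 :=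
  (integral_prod (fun p : Ed n × Ed n => f p.1 p.2) hf).symm

theorem of_integral_prod (hf : Integrable (fun p : Ed n × Ed n => f p.1 p.2))
    (hc : ∫ p : Ed n × Ed n, f p.1 p.2 = c) : HasDoubleIntegral f c :=
  ⟨hf, (integral_integral_eq hf).trans hc⟩

theorem integral_prod_eq (hf : HasDoubleIntegral f c) : ∫ p : Ed n × Ed n, f p.1 p.2 = c :=
  (integral_integral_eq hf.1).symm.trans hf.2

theorem add (hf : HasDoubleIntegral f c) (hg : HasDoubleIntegral g d) :
    HasDoubleIntegral (fun x y => f x y + g x y) (c + d) :=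
  of_integral_prod (hf.1.add hg.1) <| by
    rw [integral_add hf.1 hg.1, hf.integral_prod_eq, hg.integral_prod_eq]

theorem sub (hf : HasDoubleIntegral f c) (hg : HasDoubleIntegral g d) :
    HasDoubleIntegral (fun x y => f x y - g x y) (c - d) :=
  of_integral_prod (hf.1.sub hg.1) <| by
    rw [integral_sub hf.1 hg.1, hf.integral_prod_eq, hg.integral_prod_eq]

theorem const_mul (hf : HasDoubleIntegral f c) (r : ℝ) :
    HasDoubleIntegral (fun x y => r * f x y) (r * c) :=
  of_integral_prod (hf.1.const_mul r) <| by rw [integral_const_mul, hf.integral_prod_eq]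

theorem sum {ι : Type*} {s : Finset ι} {f : ι → Ed n → Ed n → ℝ} {c : ι → ℝ}
    (hf : ∀ i ∈ s, HasDoubleIntegral (f i) (c i)) :
    HasDoubleIntegral (fun x y => ∑ i ∈ s, f i x y) (∑ i ∈ s, c i) :=
  of_integral_prod (integrable_finsetSum s fun i hi => (hf i hi).1) <| by
    rw [integral_finsetSum s fun i hi => (hf i hi).1]
    exact Finset.sum_congr rfl fun i hi => (hf i hi).integral_prod_eq

theorem congr (hf : HasDoubleIntegral f c) (h : ∀ x y, g x y = f x y) :
    HasDoubleIntegral g c := by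
  have : g = f := funext fun x => funext fun y => h x y
  rwa [this]

theorem congr_value (hf : HasDoubleIntegral f c) (h : c = d) : HasDoubleIntegral f d := h ▸ hf

end HasDoubleIntegral

section Pairing

variable {n : ℕ} {K : Ed n → ℝ} {A B : ℝ × Ed n → ℝ}

theorem integrable_pairing (hK : BddSmooth K) {a b : Ed n → ℝ} (ha : Integrable a)
    (hb : Integrable b) :
    Integrable (fun p : Ed n × Ed n => a p.1 * b p.2 * K (p.1 - p.2)) := by
  obtain ⟨C, -, hC⟩ := hK.exists_bound
  have h1 : Integrable (fun p : Ed n × Ed n => a p.1 * b p.2) := ha.mul_prod hb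
  exact h1.mul_bdd (c := C) (hK.smooth.continuous.comp (by fun_prop)).aestronglyMeasurable
    (.of_forall fun p => hC _)

theorem hasDoubleIntegral_pairing (hK : BddSmooth K) (hA : RapidDecay A) (hB : RapidDecay B)
    (t : ℝ) : HasDoubleIntegral (fun x y => A (t, x) * B (t, y) * K (x - y))
      (pairing K (fun x => A (t, x)) fun y => B (t, y)) :=
  ⟨integrable_pairing hK (hA.integrable t) (hB.integrable t), rfl⟩

theorem pairing_eq_integral_swapped (hK : BddSmooth K) {a b : Ed n → ℝ} (ha : Integrable a)
    (hb : Integrable b) : pairing K a b = ∫ y, ∫ x, a x * b y * K (x - y) :=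
  integral_integral_swap (integrable_pairing hK ha hb)

theorem pairing_swap (hK : BddSmooth K) (heven : ∀ x, K (-x) = K x) (hA : RapidDecay A)
    (hB : RapidDecay B) (t : ℝ) :
    pairing K (fun x => A (t, x)) (fun y => B (t, y)) =
      pairing K (fun x => B (t, x)) fun y => A (t, y) := by
  rw [pairing_eq_integral_swapped hK (hA.integrable t) (hB.integrable t), pairing]
  refine integral_congr_ae (.of_forall fun y => integral_congr_ae (.of_forall fun x => ?_))
  change A (t, x) * B (t, y) * K (x - y) = B (t, y) * A (t, x) * K (y - x)
  rw [← heven (x - y), neg_sub]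
  ring

theorem integral_mul_kernel_by_parts {L : Ed n → ℝ} (hL : Differentiable ℝ L)
    (hLb : ∃ C, ∀ y, ‖L y‖ ≤ C) (v : Ed n) (hLc : Continuous (dirD v L))
    (hLb' : ∃ C, ∀ y, ‖dirD v L y‖ ≤ C) (hB : RapidDecay B) (t : ℝ) :
    ∫ y, dirD ((0, v) : ℝ × Ed n) B (t, y) * L y = -∫ y, B (t, y) * dirD v L y := by
  obtain ⟨C, hC⟩ := hLb
  obtain ⟨C', hC'⟩ := hLb'
  have hs : Differentiable ℝ fun y => B (t, y) := fun y =>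
    (hasFDerivAt_slice_space hB.differentiable t y).differentiableAt
  have e : ∀ y, fderiv ℝ (fun y => B (t, y)) y v = dirD ((0, v) : ℝ × Ed n) B (t, y) :=
    fun y => fderiv_slice_space hB.differentiable t y v
  have key := integral_mul_fderiv_eq_neg_fderiv_mul_of_integrable (μ := volume) (f := L)
    (g := fun y => B (t, y)) (v := v)
    ((hB.integrable t).bdd_mul (c := C') hLc.aestronglyMeasurable (.of_forall hC'))
    (by
      simp only [e]
      exact ((hB.dirD (0, v)).integrable t).bdd_mul (c := C) hL.continuous.aestronglyMeasurable
        (.of_forall hC))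
    ((hB.integrable t).bdd_mul (c := C) hL.continuous.aestronglyMeasurable (.of_forall hC))
    (fun y _ => hL y) (fun y _ => hs y)
  simp only [e] at key
  simpa only [mul_comm, dirD] using key

theorem pairing_dirD_right (hK : BddSmooth K) (hB : RapidDecay B) (a : Ed n → ℝ)
    (v : Ed n) (t : ℝ) :
    pairing K a (fun y => dirD ((0, v) : ℝ × Ed n) B (t, y)) =
      pairing (dirD v K) a fun y => B (t, y) := by
  obtain ⟨C, -, hC⟩ := hK.exists_bound
  obtain ⟨C', -, hC'⟩ := (hK.dirD v).exists_bound
  unfold pairing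
  congr 1
  funext x
  have hd : dirD v (fun y => K (x - y)) = fun y => -dirD v K (x - y) := by
    funext y
    have := ((hK.differentiable (x - y)).hasFDerivAt.comp y ((hasFDerivAt_id y).const_sub x)).fderiv
    simpa using! DFunLike.congr_fun this v
  have key := integral_mul_kernel_by_parts (L := fun y => K (x - y))
    (hK.differentiable.comp (by fun_prop)) ⟨C, fun y => hC _⟩ v
    (by rw [hd]; exact ((hK.dirD v).smooth.continuous.comp (by fun_prop)).neg)
    ⟨C', fun y => by rw [hd, norm_neg]; exact hC' _⟩ hB t
  simp only [mul_assoc, integral_const_mul, key, hd, mul_neg, integral_neg, neg_neg]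

theorem pairing_dirD_left (hK : BddSmooth K) (hA : RapidDecay A) (hB : RapidDecay B)
    (v : Ed n) (t : ℝ) :
    pairing K (fun x => dirD ((0, v) : ℝ × Ed n) A (t, x)) (fun y => B (t, y)) =
      -pairing (dirD v K) (fun x => A (t, x)) fun y => B (t, y) := by
  obtain ⟨C, -, hC⟩ := hK.exists_bound
  obtain ⟨C', -, hC'⟩ := (hK.dirD v).exists_bound
  rw [pairing_eq_integral_swapped hK ((hA.dirD (0, v)).integrable t) (hB.integrable t),
    pairing_eq_integral_swapped (hK.dirD v) (hA.integrable t) (hB.integrable t), ← integral_neg]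
  congr 1
  funext y
  have hd : dirD v (fun x => K (x - y)) = fun x => dirD v K (x - y) := by
    funext x
    have := ((hK.differentiable (x - y)).hasFDerivAt.comp x ((hasFDerivAt_id x).sub_const y)).fderiv
    simpa using! DFunLike.congr_fun this v
  have key := integral_mul_kernel_by_parts (L := fun x => K (x - y))
    (hK.differentiable.comp (by fun_prop)) ⟨C, fun y => hC _⟩ v
    (by rw [hd]; exact (hK.dirD v).smooth.continuous.comp (by fun_prop))
    ⟨C', fun y => by rw [hd]; exact hC' _⟩ hA t
  simp only [mul_right_comm _ (B (t, y)), integral_mul_const, key, hd, neg_mul]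

theorem hasDerivAt_pairing (hK : BddSmooth K) (hA : RapidDecay A) (hB : RapidDecay B) (t : ℝ) :
    HasDerivAt (fun s => pairing K (fun x => A (s, x)) fun y => B (s, y))
      (pairing K (fun x => dirD (timeDir n) A (t, x)) (fun y => B (t, y)) +
        pairing K (fun x => A (t, x)) fun y => dirD (timeDir n) B (t, y)) t := by
  obtain ⟨C, hC0, hC⟩ := hK.exists_bound
  obtain ⟨gA, hgA, hgA0, hA'⟩ := hA.exists_bound (t - 1) (t + 1)
  obtain ⟨gB, hgB, hgB0, hB'⟩ := hB.exists_bound (t - 1) (t + 1)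
  obtain ⟨dA, hdA, hdA0, hDA⟩ := (hA.dirD (timeDir n)).exists_bound (t - 1) (t + 1)
  obtain ⟨dB, hdB, hdB0, hDB⟩ := (hB.dirD (timeDir n)).exists_bound (t - 1) (t + 1)
  have h1 := hasDoubleIntegral_pairing hK (hA.dirD (timeDir n)) hB t
  have h2 := hasDoubleIntegral_pairing hK hA (hB.dirD (timeDir n)) t
  have h0 := fun s => hasDoubleIntegral_pairing hK hA hB s
  have hK' : Continuous fun p : Ed n × Ed n => K (p.1 - p.2) :=
    hK.smooth.continuous.comp (by fun_prop)
  rw [← (h1.add h2).integral_prod_eq]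
  simp only [← fun s => (h0 s).integral_prod_eq]
  refine (hasDerivAt_integral_of_dominated_loc_of_deriv_le (μ := volume)
    (F := fun s (p : Ed n × Ed n) => A (s, p.1) * B (s, p.2) * K (p.1 - p.2))
    (F' := fun s (p : Ed n × Ed n) => dirD (timeDir n) A (s, p.1) * B (s, p.2) * K (p.1 - p.2) +
      A (s, p.1) * dirD (timeDir n) B (s, p.2) * K (p.1 - p.2))
    (bound := fun p => (dA p.1 * gB p.2 + gA p.1 * dB p.2) * C)
    (s := Set.Icc (t - 1) (t + 1)) (Icc_mem_nhds (by linarith) (by linarith))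
    (.of_forall fun s => (h0 s).1.aestronglyMeasurable) (h0 t).1
    (h1.add h2).1.aestronglyMeasurable (.of_forall fun p s hs => ?_)
    (((hdA.mul_prod hgB).add (hgA.mul_prod hdB)).mul_const C) (.of_forall fun p s hs => ?_)).2
  · rw [← add_mul, norm_mul]
    have b1 := hA' s hs p.1
    have b2 := hB' s hs p.2
    have b3 := hDA s hs p.1
    have b4 := hDB s hs p.2
    have := hgA0 p.1
    have := hdA0 p.1
    have := hgB0 p.2
    have := hdB0 p.2
    refine mul_le_mul ((norm_add_le _ _).trans (add_le_add ?_ ?_)) (hC _) (norm_nonneg _)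
      (by positivity)
    · rw [norm_mul]; gcongr
    · rw [norm_mul]; gcongr
  · rw [← add_mul]
    exact ((hasDerivAt_slice_time hA.differentiable s p.1).mul
      (hasDerivAt_slice_time hB.differentiable s p.2)).mul_const _

theorem hasFDerivAt_integral_kernel (hK : BddSmooth K) {b : Ed n → ℝ} (hb : Integrable b)
    (x : Ed n) :
    HasFDerivAt (fun y => ∫ z, K (y - z) * b z) (∫ z, b z • fderiv ℝ K (x - z)) x := by
  obtain ⟨C, -, hC⟩ := hK.exists_bound
  obtain ⟨C', -, hC'⟩ := hK.exists_fderiv_bound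
  have hc : ∀ y, Continuous fun z => K (y - z) := fun y => hK.smooth.continuous.comp (by fun_prop)
  have hc' : Continuous fun z => fderiv ℝ K (x - z) :=
    (hK.smooth.continuous_fderiv (by simp)).comp (by fun_prop)
  refine hasFDerivAt_integral_of_dominated_of_fderiv_le (μ := volume)
    (F' := fun y z => b z • fderiv ℝ K (y - z)) (bound := fun z => ‖b z‖ * C') Filter.univ_mem
    (.of_forall fun y => (hc y).aestronglyMeasurable.mul hb.aestronglyMeasurable)
    (hb.bdd_mul (c := C) (hc x).aestronglyMeasurable (.of_forall fun z => hC _))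
    (hb.aestronglyMeasurable.smul hc'.aestronglyMeasurable)
    (.of_forall fun z y _ => ?_) (hb.norm.mul_const C') (.of_forall fun z y _ => ?_)
  · rw [norm_smul]; gcongr; exact hC' _
  · have h1 : HasFDerivAt (fun y => K (y - z)) (fderiv ℝ K (y - z)) y := by
      simpa using! (hK.differentiable (y - z)).hasFDerivAt.comp y ((hasFDerivAt_id y).sub_const z)
    exact h1.mul_const (b z)

end Pairing

section LocalConservationLaws

variable {n : ℕ}

/-- Mass density of a space-time function. -/
def density (U : ℝ × Ed n → ℂ) (p : ℝ × Ed n) : ℝ := ((starRingEnd ℂ) (U p) * U p).re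

/-- Mass current of a space-time function, `k`-th component. -/
def current (U : ℝ × Ed n → ℂ) (k : Fin n) (p : ℝ × Ed n) : ℝ :=
  ((starRingEnd ℂ) (U p) * dirD (spaceDir k) U p).im

/-- Real part of `conj (∂_k U) ∂_l U`. -/
def stress (U : ℝ × Ed n → ℂ) (k l : Fin n) (p : ℝ × Ed n) : ℝ :=
  ((starRingEnd ℂ) (dirD (spaceDir k) U p) * dirD (spaceDir l) U p).re

/-- Spatial Laplacian of a space-time function. -/
def spaceLap (U : ℝ × Ed n → ℂ) (p : ℝ × Ed n) : ℂ :=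
  ∑ l, dirD (spaceDir l) (dirD (spaceDir l) U) p

theorem RapidDecay.conj_mul {A B : ℝ × Ed n → ℂ} (hA : RapidDecay A) (hB : RapidDecay B) :
    RapidDecay (fun p => (starRingEnd ℂ) (A p) * B p) :=
  (hA.clm_comp (conjCLE : ℂ →L[ℝ] ℂ)).mul hB

theorem RapidDecay.re {A : ℝ × Ed n → ℂ} (hA : RapidDecay A) : RapidDecay (fun p => (A p).re) :=
  hA.clm_comp reCLM

theorem RapidDecay.im {A : ℝ × Ed n → ℂ} (hA : RapidDecay A) : RapidDecay (fun p => (A p).im) :=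
  hA.clm_comp imCLM

theorem dirD_conj_mul {A B : ℝ × Ed n → ℂ} (hA : Differentiable ℝ A) (hB : Differentiable ℝ B)
    (v : ℝ × Ed n) : dirD v (fun p => (starRingEnd ℂ) (A p) * B p) = fun p =>
      (starRingEnd ℂ) (A p) * dirD v B p + (starRingEnd ℂ) (dirD v A p) * B p := by
  have h1 := dirD_clm (conjCLE : ℂ →L[ℝ] ℂ) hA v
  have h2 := dirD_mul (A := fun p => (conjCLE : ℂ →L[ℝ] ℂ) (A p))
    ((conjCLE : ℂ →L[ℝ] ℂ).differentiable.comp hA) hB v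
  rw [h1] at h2
  exact h2

theorem dirD_re {A : ℝ × Ed n → ℂ} (hA : Differentiable ℝ A) (v : ℝ × Ed n) :
    dirD v (fun p => (A p).re) = fun p => (dirD v A p).re := dirD_clm reCLM hA v

theorem dirD_im {A : ℝ × Ed n → ℂ} (hA : Differentiable ℝ A) (v : ℝ × Ed n) :
    dirD v (fun p => (A p).im) = fun p => (dirD v A p).im := dirD_clm imCLM hA v

variable {U : ℝ × Ed n → ℂ}

theorem dirD_density (hU : RapidDecay U) (v : ℝ × Ed n) :
    dirD v (density U) = fun p => 2 * ((starRingEnd ℂ) (U p) * dirD v U p).re := by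
  have h := dirD_re (hU.conj_mul hU).differentiable v
  rw [dirD_conj_mul hU.differentiable hU.differentiable] at h
  refine Eq.trans h (funext fun p => ?_)
  simp only [add_re, mul_re, conj_re, conj_im]
  ring

theorem dirD_dirD_density (hU : RapidDecay U) (v : ℝ × Ed n) :
    dirD v (dirD v (density U)) = fun p =>
      (2 * ((starRingEnd ℂ) (U p) * dirD v (dirD v U) p +
        (starRingEnd ℂ) (dirD v U p) * dirD v U p)).re := by
  have hc := hU.conj_mul (hU.dirD v)
  have h := dirD_clm ((2 : ℝ) • reCLM) hc.differentiable v
  rw [dirD_conj_mul hU.differentiable (hU.dirD v).differentiable] at h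
  rw [dirD_density hU]
  refine Eq.trans h (funext fun p => ?_)
  simp

theorem dirD_dirD_dirD_density (hU : RapidDecay U) (v w : ℝ × Ed n) (p : ℝ × Ed n) :
    dirD w (dirD v (dirD v (density U))) p =
      2 * ((starRingEnd ℂ) (U p) * dirD w (dirD v (dirD v U)) p +
        (starRingEnd ℂ) (dirD w U p) * dirD v (dirD v U) p +
        2 * ((starRingEnd ℂ) (dirD v U p) * dirD w (dirD v U) p)).re := by
  have hv := hU.dirD v
  have h1 := hU.conj_mul (hv.dirD v)
  have h2 := hv.conj_mul hv
  have h := dirD_clm ((2 : ℝ) • reCLM)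
    (h1.differentiable.fun_add h2.differentiable) w
  rw [dirD_add h1.differentiable h2.differentiable, dirD_conj_mul hU.differentiable
    (hv.dirD v).differentiable, dirD_conj_mul hv.differentiable hv.differentiable] at h
  rw [dirD_dirD_density hU]
  have e : (fun p => (2 * ((starRingEnd ℂ) (U p) * dirD v (dirD v U) p +
      (starRingEnd ℂ) (dirD v U p) * dirD v U p)).re) = fun p => ((2 : ℝ) • reCLM)
      ((starRingEnd ℂ) (U p) * dirD v (dirD v U) p +
        (starRingEnd ℂ) (dirD v U p) * dirD v U p) := by
    funext p; simp
  rw [e, h]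
  simp
  ring

theorem mass_conservation (hU : RapidDecay U) {p : ℝ × Ed n} {w : ℝ}
    (heq : dirD (timeDir n) U p = I * ((1 / 2) * spaceLap U p - w * U p)) :
    dirD (timeDir n) (density U) p = -∑ l, dirD (spaceDir l) (current U l) p := by
  have h : ∀ l, dirD (spaceDir l) (current U l) p =
      ((starRingEnd ℂ) (U p) * dirD (spaceDir l) (dirD (spaceDir l) U) p).im := fun l => by
    have hl := hU.dirD (spaceDir l)
    have h := dirD_im (hU.conj_mul hl).differentiable (spaceDir l)
    rw [dirD_conj_mul hU.differentiable hl.differentiable] at h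
    refine (congrFun h p).trans ?_
    simp only [add_im, mul_im, conj_re, conj_im]
    ring
  simp only [h]
  rw [← im_sum, ← Finset.mul_sum, ← spaceLap, dirD_density hU]
  simp only [heq]
  simp
  ring

theorem momentum_conservation (hU : RapidDecay U) (k : Fin n) {p : ℝ × Ed n} {w w' : ℝ}
    (heq : dirD (timeDir n) U p = I * ((1 / 2) * spaceLap U p - w * U p))
    (heq' : dirD (spaceDir k) (dirD (timeDir n) U) p = I * ((1 / 2) *
      dirD (spaceDir k) (spaceLap U) p - (w' * U p + w * dirD (spaceDir k) U p))) :
    dirD (timeDir n) (current U k) p =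
      ∑ l, ((1 / 4) * dirD (spaceDir k) (dirD (spaceDir l) (dirD (spaceDir l) (density U))) p -
        dirD (spaceDir l) (stress U k l) p) - density U p * w' := by
  have hk := hU.dirD (spaceDir k)
  have hS : dirD (spaceDir k) (spaceLap U) p =
      ∑ l, dirD (spaceDir k) (dirD (spaceDir l) (dirD (spaceDir l) U)) p :=
    congrFun (dirD_sum _ (fun l => ((hU.dirD (spaceDir l)).dirD (spaceDir l)).differentiable) _) p
  have h1 : dirD (timeDir n) (current U k) p =
      ((starRingEnd ℂ) (U p) * dirD (spaceDir k) (dirD (timeDir n) U) p +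
        (starRingEnd ℂ) (dirD (timeDir n) U p) * dirD (spaceDir k) U p).im := by
    have h := dirD_im (hU.conj_mul hk).differentiable (timeDir n)
    rw [dirD_conj_mul hU.differentiable hk.differentiable, dirD_comm hU.smooth] at h
    exact congrFun h p
  have h2 : ∀ l, (1 / 4) * dirD (spaceDir k) (dirD (spaceDir l) (dirD (spaceDir l) (density U))) p -
      dirD (spaceDir l) (stress U k l) p = (1 / 2) *
        ((starRingEnd ℂ) (U p) * dirD (spaceDir k) (dirD (spaceDir l) (dirD (spaceDir l) U)) p -
        (starRingEnd ℂ) (dirD (spaceDir k) U p) * dirD (spaceDir l) (dirD (spaceDir l) U) p).re :=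
    fun l => by
      have hl := hU.dirD (spaceDir l)
      have h := dirD_re (hk.conj_mul hl).differentiable (spaceDir l)
      rw [dirD_conj_mul hk.differentiable hl.differentiable] at h
      rw [show dirD (spaceDir l) (stress U k l) p = _ from congrFun h p,
        dirD_dirD_dirD_density hU, dirD_comm hU.smooth (spaceDir l) (spaceDir k)]
      simp
      ring
  simp only [h2]
  rw [← Finset.mul_sum, ← re_sum, Finset.sum_sub_distrib, ← Finset.mul_sum, ← Finset.mul_sum,
    ← hS, ← spaceLap, h1, heq, heq', density]
  simp
  ring

end LocalConservationLaws

theorem dirD_neg_arg {E : Type*} [NormedAddCommGroup E] [NormedSpace ℝ E] {h : E → ℝ} {c : ℝ}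
    (hh : ∀ x, h (-x) = c * h x) (hd : Differentiable ℝ h) (v x : E) :
    dirD v h (-x) = -c * dirD v h x := by
  have h1 := ((hd (-x)).hasFDerivAt.comp x (hasFDerivAt_id x).neg).unique
    (((hd x).hasFDerivAt.const_mul c).congr_of_eventuallyEq (.of_forall hh))
  have h2 := DFunLike.congr_fun h1 v
  simp only [dirD]
  simp at h2
  linarith

section Potential

variable {n : ℕ} {V : Ed n → ℝ} {u : ℝ → Ed n → ℂ}

theorem pd_slice {A : ℝ × Ed n → ℂ} (hA : RapidDecay A) (k : Fin n) (t : ℝ) (x : Ed n) :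
    pd k (fun y => A (t, y)) x = dirD (spaceDir k) A (t, x) :=
  fderiv_slice_space hA.differentiable t x _

theorem pdR_slice {A : ℝ × Ed n → ℝ} (hA : RapidDecay A) (k : Fin n) (t : ℝ) (x : Ed n) :
    pdR k (fun y => A (t, y)) x = dirD (spaceDir k) A (t, x) :=
  fderiv_slice_space hA.differentiable t x _

theorem IsHartreeSolution.rapidDecay (hu : IsHartreeSolution V u) :
    RapidDecay (fun p : ℝ × Ed n => u p.1 p.2) := ⟨hu.1, hu.2.1⟩

theorem dens_eq_density (t : ℝ) (x : Ed n) :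
    dens u t x = density (fun p : ℝ × Ed n => u p.1 p.2) (t, x) := by
  simp only [dens, density, conj_mul']
  norm_cast

theorem curr_eq_current (hU : RapidDecay (fun p : ℝ × Ed n => u p.1 p.2)) (k : Fin n) (t : ℝ)
    (x : Ed n) : curr u k t x = current (fun p : ℝ × Ed n => u p.1 p.2) k (t, x) := by
  rw [curr, current, ← pd_slice hU]

theorem lapC_eq_spaceLap (hU : RapidDecay (fun p : ℝ × Ed n => u p.1 p.2)) (t : ℝ) (x : Ed n) :
    lapC (u t) x = spaceLap (fun p : ℝ × Ed n => u p.1 p.2) (t, x) := by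
  refine Finset.sum_congr rfl fun k _ => ?_
  rw [← pd_slice (hU.dirD _)]
  congr 1
  funext y
  exact pd_slice hU k t y

/-- The potential generated by the mass density. -/
def hartreePotential (V : Ed n → ℝ) (u : ℝ → Ed n → ℂ) (t : ℝ) (x : Ed n) : ℝ :=
  ∫ z, V (x - z) * dens u t z

theorem IsHartreeSolution.timeDeriv_eq (hu : IsHartreeSolution V u) (t : ℝ) (x : Ed n) :
    dirD (timeDir n) (fun p : ℝ × Ed n => u p.1 p.2) (t, x) =
      I * ((1 / 2) * spaceLap (fun p : ℝ × Ed n => u p.1 p.2) (t, x) -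
        hartreePotential V u t x * u t x) := by
  have h := hu.2.2 t x
  rw [(hasDerivAt_slice_time hu.rapidDecay.differentiable t x).deriv,
    lapC_eq_spaceLap hu.rapidDecay] at h
  have h' : ∀ z : ℂ, z = -(I * (I * z)) := fun z => by rw [← mul_assoc, I_mul_I]; ring
  rw [h' (dirD _ _ _), h, hartreePotential]
  simp only [dens]
  ring

theorem IsHartreeSolution.spaceDeriv_timeDeriv_eq (hV : BddSmooth V) (hu : IsHartreeSolution V u)
    (k : Fin n) (t : ℝ) (x : Ed n) :
    dirD (spaceDir k) (dirD (timeDir n) (fun p : ℝ × Ed n => u p.1 p.2)) (t, x) =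
      I * ((1 / 2) * dirD (spaceDir k) (spaceLap (fun p : ℝ × Ed n => u p.1 p.2)) (t, x) -
        (pdR k (hartreePotential V u t) x * u t x + hartreePotential V u t x *
          dirD (spaceDir k) (fun p : ℝ × Ed n => u p.1 p.2) (t, x))) := by
  have hU := hu.rapidDecay
  have hdens : Integrable (dens u t) := by
    have := (hU.conj_mul hU).re.integrable t
    exact this.congr (.of_forall fun x => (dens_eq_density t x).symm)
  have hW : HasFDerivAt (hartreePotential V u t) _ x := hasFDerivAt_integral_kernel hV hdens x
  have hS : Differentiable ℝ (spaceLap (fun p : ℝ × Ed n => u p.1 p.2)) :=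
    Differentiable.fun_sum fun l _ => ((hU.dirD (spaceDir l)).dirD (spaceDir l)).differentiable
  have h1 := hasFDerivAt_slice_space hU.differentiable t x
  have h2 := hasFDerivAt_slice_space hS t x
  have h3 := (((h2.const_mul (1 / 2 : ℂ)).sub
    ((ofRealCLM.hasFDerivAt.comp x hW).mul h1)).const_mul I)
  rw [← pd_slice (hU.dirD _), pd, show (fun y => dirD (timeDir n)
    (fun p : ℝ × Ed n => u p.1 p.2) (t, y)) = _ from funext fun y => hu.timeDeriv_eq t y]
  refine (DFunLike.congr_fun (HasFDerivAt.fderiv h3) _).trans ?_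
  rw [pdR, hW.fderiv]
  simp [dirD]
  ring

end Potential

section VirialIdentities

variable {n : ℕ} {K h : Ed n → ℝ} {U : ℝ × Ed n → ℂ}

/-- The pairing of two space-time functions at time `t`. -/
def pairingAt (K : Ed n → ℝ) (t : ℝ) (A B : ℝ × Ed n → ℝ) : ℝ :=
  pairing K (fun x => A (t, x)) fun y => B (t, y)

/-- Partial derivative of a kernel. -/
abbrev kerD (k : Fin n) (K : Ed n → ℝ) : Ed n → ℝ := dirD (EuclideanSpace.single k 1) K

theorem pairingAt_right (hK : BddSmooth K) (A : ℝ × Ed n → ℝ) {B : ℝ × Ed n → ℝ}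
    (hB : RapidDecay B) (k : Fin n) (t : ℝ) :
    pairingAt K t A (dirD (spaceDir k) B) = pairingAt (kerD k K) t A B :=
  pairing_dirD_right hK hB _ _ t

theorem pairingAt_left (hK : BddSmooth K) {A B : ℝ × Ed n → ℝ} (hA : RapidDecay A)
    (hB : RapidDecay B) (k : Fin n) (t : ℝ) :
    pairingAt K t (dirD (spaceDir k) A) B = -pairingAt (kerD k K) t A B :=
  pairing_dirD_left hK hA hB _ t

theorem RapidDecay.density (hU : RapidDecay U) : RapidDecay (density U) := (hU.conj_mul hU).re

theorem RapidDecay.current (hU : RapidDecay U) (k : Fin n) : RapidDecay (current U k) :=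
  (hU.conj_mul (hU.dirD _)).im

theorem RapidDecay.stress (hU : RapidDecay U) (k l : Fin n) : RapidDecay (stress U k l) :=
  ((hU.dirD _).conj_mul (hU.dirD _)).re

theorem pairingAt_hess_eq_lap (h1 : ∀ k, BddSmooth (kerD k h)) (hs : ContDiff ℝ (⊤ : ℕ∞) h)
    {A : ℝ × Ed n → ℝ} (hA : RapidDecay A) (k l : Fin n) (t : ℝ) :
    pairingAt (kerD k (kerD l h)) t (dirD (spaceDir k) A) (dirD (spaceDir l) A) =
      pairingAt (kerD k (kerD k h)) t (dirD (spaceDir l) A) (dirD (spaceDir l) A) := by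
  rw [pairingAt_left ((h1 l).dirD _) hA (hA.dirD _), pairingAt_left ((h1 k).dirD _) hA (hA.dirD _)]
  unfold kerD
  rw [dirD_comm hs (EuclideanSpace.single k 1) (EuclideanSpace.single l 1),
    dirD_comm (contDiff_dirD hs (EuclideanSpace.single k 1)) (EuclideanSpace.single k 1)
    (EuclideanSpace.single l 1)]

theorem pairing_symmetric_identity (h1 : ∀ k, BddSmooth (kerD k h)) (hs : ContDiff ℝ (⊤ : ℕ∞) h)
    (hU : RapidDecay U) (k l : Fin n) (t : ℝ) :
    pairingAt (kerD k h) t (dirD (spaceDir l) (current U l)) (current U k) =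
      (1 / 2) * pairingAt (kerD k (kerD k h)) t (dirD (spaceDir l) (density U))
          (dirD (spaceDir l) (density U)) +
        ((1 / 4) * pairingAt (kerD k h) t (density U)
            (dirD (spaceDir k) (dirD (spaceDir l) (dirD (spaceDir l) (density U)))) -
          pairingAt (kerD k h) t (density U) (dirD (spaceDir l) (stress U k l))) +
        (pairingAt (kerD k (kerD l h)) t (density U) (stress U k l) -
          (1 / 4) * pairingAt (kerD k (kerD l h)) t (dirD (spaceDir k) (density U))
            (dirD (spaceDir l) (density U)) -
          pairingAt (kerD k (kerD l h)) t (current U l) (current U k)) := by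
  have hρ := hU.density
  have hkl : kerD l (kerD k h) = kerD k (kerD l h) := dirD_comm hs _ _
  rw [pairingAt_left (h1 k) (hU.current l) (hU.current k), hkl,
    pairingAt_right (h1 k) _ ((hρ.dirD _).dirD _), pairingAt_right ((h1 k).dirD _) _ (hρ.dirD _),
    pairingAt_right (h1 k) _ (hU.stress k l), hkl, pairingAt_hess_eq_lap h1 hs hρ,
    pairingAt_left ((h1 k).dirD _) hρ (hρ.dirD _)]
  ring

theorem hasDoubleIntegral_commutator (h1 : ∀ k, BddSmooth (kerD k h))
    (heven : ∀ k l x, kerD k (kerD l h) (-x) = kerD k (kerD l h) x)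
    (hU : RapidDecay U) (k l : Fin n) (t : ℝ) :
    HasDoubleIntegral (fun x y => kerD k (kerD l h) (x - y) *
      ((starRingEnd ℂ) (U (t, x) * dirD (spaceDir k) U (t, y) -
        U (t, y) * dirD (spaceDir k) U (t, x)) *
        (U (t, x) * dirD (spaceDir l) U (t, y) - U (t, y) * dirD (spaceDir l) U (t, x))).re)
      (2 * (pairingAt (kerD k (kerD l h)) t (density U) (stress U k l) -
          (1 / 4) * pairingAt (kerD k (kerD l h)) t (dirD (spaceDir k) (density U))
            (dirD (spaceDir l) (density U)) -
          pairingAt (kerD k (kerD l h)) t (current U l) (current U k))) := by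
  have hK : BddSmooth (kerD k (kerD l h)) := (h1 l).dirD _
  have hρ := hU.density
  have T1 := hasDoubleIntegral_pairing hK hρ (hU.stress k l) t
  have T2 := hasDoubleIntegral_pairing hK (hU.stress k l) hρ t
  have T3 := hasDoubleIntegral_pairing hK (hρ.dirD (spaceDir k)) (hρ.dirD (spaceDir l)) t
  have T4 := hasDoubleIntegral_pairing hK (hρ.dirD (spaceDir l)) (hρ.dirD (spaceDir k)) t
  have T5 := hasDoubleIntegral_pairing hK (hU.current l) (hU.current k) t
  have T6 := hasDoubleIntegral_pairing hK (hU.current k) (hU.current l) t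
  rw [pairing_swap hK (heven k l) (hU.stress k l) hρ] at T2
  rw [pairing_swap hK (heven k l) (hρ.dirD (spaceDir l)) (hρ.dirD (spaceDir k))] at T4
  rw [pairing_swap hK (heven k l) (hU.current k) (hU.current l)] at T6
  have T := ((T1.add T2).sub ((T3.add T4).const_mul (1 / 4))).sub (T5.add T6)
  refine (T.congr (g := fun x y => _) fun x y => ?_).congr_value ?_
  · simp only [dirD_density hU]
    simp only [density, stress, current]
    simp only [map_sub, map_mul, mul_re, mul_im, sub_re, sub_im, conj_re, conj_im]
    ring
  · simp only [pairingAt]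
    ring

end VirialIdentities

/-- Quadratic Morawetz identity for the Hartree equation:
`M'(t) = (1/2)⟨∇ρ, Δh ⋆ ∇ρ⟩ + ∫∫ ρ(t,x) ∇h(x-y)·(ρ ∇(V⋆ρ))(t,y) dx dy + R(t)`. -/
theorem hartree_quadratic_morawetz_identity {n : ℕ} (hn : 1 ≤ n)
    (h : Ed n → ℝ) (hsmooth : ContDiff ℝ (⊤ : ℕ∞) h) (heven : ∀ x, h (-x) = h x)
    (hbdd : ∀ i : ℕ, 1 ≤ i → ∃ C : ℝ, ∀ x, ‖iteratedFDeriv ℝ i h x‖ ≤ C)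
    (V : Ed n → ℝ) (hVsmooth : ContDiff ℝ (⊤ : ℕ∞) V) (hVeven : ∀ x, V (-x) = V x)
    (hVbdd : ∀ i : ℕ, ∃ C : ℝ, ∀ x, ‖iteratedFDeriv ℝ i V x‖ ≤ C)
    (u : ℝ → Ed n → ℂ) (hu : IsHartreeSolution V u) :
    ∀ t : ℝ, HasDerivAt (morawetzM h u)
      ((1/2) * (∫ x, ∫ y, lapR h (x - y) *
          ∑ k, pdR k (fun z => dens u t z) x * pdR k (fun z => dens u t z) y)
        + (∫ x, ∫ y, dens u t x * ∑ k, pdR k h (x - y) *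
            (dens u t y * pdR k (fun y' => ∫ z, V (y' - z) * dens u t z) y))
        + morawetzR h u t) t := by
  intro t
  set U : ℝ × Ed n → ℂ := fun p => u p.1 p.2
  have hU : RapidDecay U := hu.rapidDecay
  have hV : BddSmooth V := ⟨hVsmooth, hVbdd⟩
  have hρ := hU.density
  have h1 : ∀ k, BddSmooth (kerD k h) := fun k => bddSmooth_dirD hsmooth hbdd _
  have hhess : ∀ k l x, kerD k (kerD l h) (-x) = kerD k (kerD l h) x := fun k l x => by
    have hodd : ∀ y, kerD l h (-y) = -1 * kerD l h y :=
      dirD_neg_arg (by simpa using heven) (hsmooth.differentiable (by simp)) _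
    simpa using dirD_neg_arg hodd (h1 l).differentiable (EuclideanSpace.single k 1) x
  have hdens : ∀ s x, dens u s x = density U (s, x) := dens_eq_density
  have hcurr : ∀ k s x, curr u k s x = current U k (s, x) := curr_eq_current hU
  have hdd : ∀ k x, pdR k (fun z => dens u t z) x = dirD (spaceDir k) (density U) (t, x) :=
    fun k x => by simp only [hdens]; exact pdR_slice hρ k t x
  have hM : morawetzM h u = fun s => -∑ k, pairingAt (kerD k h) s (density U) (current U k) := by
    funext s
    have H := HasDoubleIntegral.sum (s := Finset.univ) fun k _ =>
      hasDoubleIntegral_pairing (h1 k) hρ (hU.current k) s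
    rw [morawetzM]
    refine congrArg Neg.neg (H.congr (g := fun x y => dens u s x * ∑ k, pdR k h (x - y) *
      curr u k s y) fun x y => ?_).2
    rw [hdens, Finset.mul_sum]
    refine Finset.sum_congr rfl fun k _ => ?_
    rw [hcurr]
    change _ * (kerD k h (x - y) * _) = _
    ring
  have hmass : ∀ k, pairingAt (kerD k h) t (dirD (timeDir n) (density U)) (current U k) =
      -∑ l, pairingAt (kerD k h) t (dirD (spaceDir l) (current U l)) (current U k) := fun k => by
    have H := (HasDoubleIntegral.sum (s := Finset.univ) fun l _ =>
      hasDoubleIntegral_pairing (h1 k) ((hU.current l).dirD (spaceDir l)) (hU.current k)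
        t).const_mul (-1)
    rw [neg_eq_neg_one_mul]
    refine (H.congr fun x y => ?_).2
    beta_reduce
    rw [mass_conservation hU (hu.timeDeriv_eq t x), ← Finset.sum_mul, ← Finset.sum_mul]
    ring
  have hpot : HasDoubleIntegral (fun x y => dens u t x * ∑ k, pdR k h (x - y) *
      (dens u t y * pdR k (fun y' => ∫ z, V (y' - z) * dens u t z) y))
      (∑ k, (∑ l, ((1 / 4) * pairingAt (kerD k h) t (density U)
          (dirD (spaceDir k) (dirD (spaceDir l) (dirD (spaceDir l) (density U)))) -
        pairingAt (kerD k h) t (density U) (dirD (spaceDir l) (stress U k l))) -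
        pairingAt (kerD k h) t (density U) (dirD (timeDir n) (current U k)))) := by
    have H := HasDoubleIntegral.sum (s := Finset.univ) fun k _ =>
      (HasDoubleIntegral.sum (s := Finset.univ) fun l _ =>
        ((hasDoubleIntegral_pairing (h1 k) hρ (((hρ.dirD (spaceDir l)).dirD (spaceDir l)).dirD
          (spaceDir k)) t).const_mul (1 / 4)).sub
        (hasDoubleIntegral_pairing (h1 k) hρ ((hU.stress k l).dirD (spaceDir l)) t)).sub
      (hasDoubleIntegral_pairing (h1 k) hρ ((hU.current k).dirD (timeDir n)) t)
    refine H.congr fun x y => ?_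
    rw [Finset.mul_sum]
    refine Finset.sum_congr rfl fun k _ => ?_
    have hmom := momentum_conservation hU k (hu.timeDeriv_eq t y)
      (hu.spaceDeriv_timeDeriv_eq hV k t y)
    have e : ∀ c d : ℝ, ∀ a b : Fin n → ℝ, ∑ l, ((1 / 4) * (c * a l * d) - c * b l * d) =
        c * (∑ l, ((1 / 4) * a l - b l)) * d := fun c d a b => by
      rw [Finset.mul_sum, Finset.sum_mul]
      exact Finset.sum_congr rfl fun l _ => by ring
    rw [e, hmom, hdens, hdens]
    change _ * (kerD k h (x - y) * (_ * pdR k (hartreePotential V u t) y)) = _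
    ring
  have hlap : HasDoubleIntegral (fun x y => lapR h (x - y) *
      ∑ k, pdR k (fun z => dens u t z) x * pdR k (fun z => dens u t z) y)
      (∑ k, ∑ l, pairingAt (kerD k (kerD k h)) t (dirD (spaceDir l) (density U))
        (dirD (spaceDir l) (density U))) := by
    have H := HasDoubleIntegral.sum (s := Finset.univ) fun k _ =>
      HasDoubleIntegral.sum (s := Finset.univ) fun l _ =>
        hasDoubleIntegral_pairing ((h1 k).dirD (EuclideanSpace.single k 1))
          (hρ.dirD (spaceDir l)) (hρ.dirD (spaceDir l)) t
    refine H.congr fun x y => ?_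
    rw [lapR, Finset.sum_mul_sum]
    refine Finset.sum_congr rfl fun k _ => Finset.sum_congr rfl fun l _ => ?_
    rw [hdd, hdd]
    exact mul_comm _ _
  have hrem : morawetzR h u t = ∑ k, ∑ l,
      (pairingAt (kerD k (kerD l h)) t (density U) (stress U k l) -
          (1 / 4) * pairingAt (kerD k (kerD l h)) t (dirD (spaceDir k) (density U))
            (dirD (spaceDir l) (density U)) -
          pairingAt (kerD k (kerD l h)) t (current U l) (current U k)) := by
    have H := HasDoubleIntegral.sum (s := Finset.univ) fun k _ =>
      HasDoubleIntegral.sum (s := Finset.univ) fun l _ =>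
        hasDoubleIntegral_commutator h1 hhess hU k l t
    have H' := (H.congr (g := fun x y => (∑ k, ∑ l, (hess h k l (x - y) : ℂ) *
      ((starRingEnd ℂ) (wVec u t x y k) * wVec u t x y l)).re) fun x y => ?_).2
    · rw [morawetzR, H']
      simp only [← Finset.mul_sum]
      ring
    · simp only [re_sum, re_ofReal_mul]
      refine Finset.sum_congr rfl fun k _ => Finset.sum_congr rfl fun l _ => ?_
      simp only [wVec, ← pd_slice hU]
      rfl
  rw [hM, hlap.2, hpot.2, hrem]
  refine (HasDerivAt.fun_sum fun k _ =>
    hasDerivAt_pairing (h1 k) hρ (hU.current k) t).neg.congr_deriv ?_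
  change -∑ k, (pairingAt (kerD k h) t (dirD (timeDir n) (density U)) (current U k) +
    pairingAt (kerD k h) t (density U) (dirD (timeDir n) (current U k))) = _
  rw [Finset.mul_sum, ← Finset.sum_neg_distrib, ← Finset.sum_add_distrib,
    ← Finset.sum_add_distrib]
  refine Finset.sum_congr rfl fun k _ => ?_
  rw [hmass]
  simp only [pairing_symmetric_identity h1 hsmooth hU, Finset.sum_add_distrib, Finset.mul_sum]
  ring
end
end

section
/- Quadratic identity for the one-dimensional nonlinear Klein-Gordon equation (A2.9): let g : [0,∞) → ℝ be smooth, G(ρ) = ∫₀^ρ g(ρ')dρ', and let u : ℝ × ℝ → ℂ be a smooth solution of ∂_t²u - ∂_x²u + g(|u|²)u = 0 such that u(t,·) and all its space-time derivatives are Schwartz in x, uniformly for t in compact intervals. Let h : ℝ → ℝ be a smooth even function with all derivatives of order ≥ 1 bounded. Define the energy density σ = |∂_t u|² + |∂_x u|² + G(|u|²), the momentum density j = -2 Re(∂_t ū ∂_x u), and M(t) = -∫∫ σ(t,x) h'(x-y) j(t,y) dx dy. Then M'(t) = ∫∫ |∂_t u - ∂_x u|²(t,x) h''(x-y) |∂_t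 u + ∂_x u|²(t,y) dx dy - ∫∫ G(|u|²)(t,x) h''(x-y) G(|u|²)(t,y) dx dy. -/
open MeasureTheory Filter Complex

noncomputable section

/-- `u(t,·)` and all its space-time derivatives are Schwartz in `x`, uniformly for `t`
in compact intervals (one space dimension). -/
def SchwartzDecay1 (u : ℝ → ℝ → ℂ) : Prop :=
  ∀ (N m : ℕ) (a b : ℝ), ∃ C : ℝ, ∀ t ∈ Set.Icc a b, ∀ x : ℝ,
    (1 + |x|) ^ m * ‖iteratedFDeriv ℝ N (fun p : ℝ × ℝ => u p.1 p.2) (t, x)‖ ≤ C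

/-- Time derivative `∂_t u`. -/
def dt1 (u : ℝ → ℝ → ℂ) (t x : ℝ) : ℂ := deriv (fun s => u s x) t

/-- Space derivative `∂_x u`. -/
def dx1 (u : ℝ → ℝ → ℂ) (t x : ℝ) : ℂ := deriv (u t) x

/-- A smooth decaying solution of the one-dimensional nonlinear Klein-Gordon equation
`∂_t²u - ∂_x²u + g(|u|²)u = 0`. -/
def IsNLKGSolution1 (g : ℝ → ℝ) (u : ℝ → ℝ → ℂ) : Prop :=
  ContDiff ℝ (⊤ : ℕ∞) (fun p : ℝ × ℝ => u p.1 p.2) ∧ SchwartzDecay1 u ∧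
    ∀ t x, deriv (fun s => dt1 u s x) t - deriv (fun z => dx1 u t z) x
      + ((g (‖u t x‖ ^ 2) : ℝ) : ℂ) * u t x = 0

/-- Energy density `σ = |∂_t u|² + |∂_x u|² + G(|u|²)`. -/
def nlkgEnergy (G : ℝ → ℝ) (u : ℝ → ℝ → ℂ) (t x : ℝ) : ℝ :=
  ‖dt1 u t x‖ ^ 2 + ‖dx1 u t x‖ ^ 2 + G (‖u t x‖ ^ 2)

/-- Momentum density `j = -2 Re(∂_t ū ∂_x u)`. -/
def nlkgMomentum (u : ℝ → ℝ → ℂ) (t x : ℝ) : ℝ :=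
  -2 * ((starRingEnd ℂ) (dt1 u t x) * dx1 u t x).re

/-- The bilinear form `∫∫ f(x) k(x - y) g(y) dy dx`. -/
def convForm (k f g : ℝ → ℝ) : ℝ := ∫ x : ℝ, ∫ y : ℝ, f x * k (x - y) * g y

theorem integrable_convForm {k f g : ℝ → ℝ} (hk : Continuous k) {K : ℝ} (hK : ∀ x, |k x| ≤ K)
    (hf : Integrable f) (hg : Integrable g) :
    Integrable (fun p : ℝ × ℝ => f p.1 * k (p.1 - p.2) * g p.2) (volume.prod volume) := by
  have hk' : Continuous fun p : ℝ × ℝ => k (p.1 - p.2) := by fun_prop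
  refine ((hf.mul_prod hg).bdd_mul hk'.aestronglyMeasurable
    (ae_of_all _ fun p => hK (p.1 - p.2))).congr (ae_of_all _ fun p => ?_)
  ring

theorem convForm_eq_integral_prod {k f g : ℝ → ℝ} (hk : Continuous k) {K : ℝ}
    (hK : ∀ x, |k x| ≤ K) (hf : Integrable f) (hg : Integrable g) :
    convForm k f g =
      ∫ p : ℝ × ℝ, f p.1 * k (p.1 - p.2) * g p.2 ∂(volume.prod volume) :=
  (integral_prod _ (integrable_convForm hk hK hf hg)).symm

theorem convForm_swap {k f g : ℝ → ℝ} (hk : Continuous k) {K : ℝ}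
    (hK : ∀ x, |k x| ≤ K) (hf : Integrable f) (hg : Integrable g) :
    convForm k f g = convForm (fun x => k (-x)) g f := by
  unfold convForm
  rw [integral_integral_swap (integrable_convForm hk hK hf hg)]
  refine integral_congr_ae (ae_of_all _ fun x => integral_congr_ae (ae_of_all _ fun y => ?_))
  simp only [neg_sub]
  ring

theorem convForm_add_sub_of_even {k f g : ℝ → ℝ} (hk : Continuous k) {K : ℝ}
    (hK : ∀ x, |k x| ≤ K) (heven : ∀ x, k (-x) = k x) (hf : Integrable f) (hg : Integrable g) :
    convForm k (fun x => f x + g x) (fun x => f x - g x) =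
      convForm k f f - convForm k g g := by
  have hsymm : convForm k f g = convForm k g f := by
    simpa only [heven] using convForm_swap hk hK hf hg
  rw [convForm_eq_integral_prod hk hK hf hg, convForm_eq_integral_prod hk hK hg hf] at hsymm
  rw [convForm_eq_integral_prod (f := fun x => f x + g x) (g := fun x => f x - g x) hk hK
      (hf.add hg) (hf.sub hg),
    convForm_eq_integral_prod hk hK hf hf, convForm_eq_integral_prod hk hK hg hg]
  have hff := integrable_convForm hk hK hf hf
  have hgg := integrable_convForm hk hK hg hg
  have hfg := integrable_convForm hk hK hf hg
  have hgf := integrable_convForm hk hK hg hf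
  refine (integral_congr_ae (ae_of_all _ fun p => ?_)).trans
    ((integral_sub (hff.sub hgg) (hfg.sub hgf)).trans ?_)
  · simp only [Pi.sub_apply]
    ring
  · simp only [Pi.sub_apply]
    rw [integral_sub hff hgg, integral_sub hfg hgf, hsymm, sub_self, sub_zero]

theorem convForm_deriv_right {k k' f g g' : ℝ → ℝ} (hk : ∀ x, HasDerivAt k (k' x) x)
    (hk' : Continuous k') {K K' : ℝ} (hK : ∀ x, |k x| ≤ K) (hK' : ∀ x, |k' x| ≤ K')
    (hg : ∀ x, HasDerivAt g (g' x) x) (hgi : Integrable g) (hgi' : Integrable g') :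
    convForm k f g' = convForm k' f g := by
  unfold convForm
  refine integral_congr_ae (ae_of_all _ fun x => ?_)
  simp only [mul_assoc, integral_const_mul]
  congr 1
  have hkc : Continuous k := continuous_iff_continuousAt.2 fun x => (hk x).continuousAt
  have hd (y : ℝ) : HasDerivAt (fun y => k (x - y)) (-k' (x - y)) y := by
    simpa [Function.comp_def] using (hk (x - y)).comp y ((hasDerivAt_id y).const_sub x)
  have hkx : Continuous fun y => k (x - y) := by fun_prop
  have hkx' : Continuous fun y => -k' (x - y) := by fun_prop
  have h1 := integral_mul_deriv_eq_deriv_mul_of_integrable (u := fun y => k (x - y))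
    (u' := fun y => -k' (x - y)) (v := g) (v' := g') (fun y _ => hd y) (fun y _ => hg y)
    (hgi'.bdd_mul hkx.aestronglyMeasurable (ae_of_all _ fun y => hK (x - y)))
    (hgi.bdd_mul (c := K') hkx'.aestronglyMeasurable
      (ae_of_all _ fun y => by simpa using hK' (x - y)))
    (hgi.bdd_mul hkx.aestronglyMeasurable (ae_of_all _ fun y => hK (x - y)))
  rw [h1, ← integral_neg]
  simp

theorem convForm_deriv_left {k k' f f' g : ℝ → ℝ} (hk : ∀ x, HasDerivAt k (k' x) x)
    (hk' : Continuous k') {K K' : ℝ} (hK : ∀ x, |k x| ≤ K) (hK' : ∀ x, |k' x| ≤ K')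
    (hf : ∀ x, HasDerivAt f (f' x) x) (hfi : Integrable f) (hfi' : Integrable f')
    (hgi : Integrable g) :
    convForm k f' g = -convForm k' f g := by
  have hkc : Continuous k := continuous_iff_continuousAt.2 fun x => (hk x).continuousAt
  have hd (y : ℝ) : HasDerivAt (fun y => k (-y)) (-k' (-y)) y := by
    simpa [Function.comp_def] using (hk (-y)).comp y (hasDerivAt_neg y)
  rw [convForm_swap hkc hK hfi' hgi, convForm_swap hk' hK' hfi hgi,
    convForm_deriv_right hd (by fun_prop) (fun x => hK (-x))
      (K' := K') (fun x => by simpa using hK' (-x)) hf hfi hfi']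
  simp [convForm, integral_neg]

/-- Continuity in `x` together with decay like `(1 + x²)⁻¹`, uniformly for `t` in compact
intervals. -/
def DecayingDensity (f : ℝ → ℝ → ℝ) : Prop :=
  (∀ t, Continuous (f t)) ∧ ∀ a b : ℝ, ∃ C : ℝ, ∀ t ∈ Set.Icc a b, ∀ x : ℝ,
    |f t x| ≤ C * (1 + x ^ 2)⁻¹

namespace DecayingDensity

variable {f g : ℝ → ℝ → ℝ}

theorem integrable (hf : DecayingDensity f) (t : ℝ) : Integrable (f t) := by
  obtain ⟨C, hC⟩ := hf.2 t t
  exact (integrable_inv_one_add_sq.const_mul C).mono' (hf.1 t).aestronglyMeasurable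
    (ae_of_all _ (hC t ⟨le_rfl, le_rfl⟩))

theorem add (hf : DecayingDensity f) (hg : DecayingDensity g) :
    DecayingDensity fun t x => f t x + g t x := by
  refine ⟨fun t => (hf.1 t).add (hg.1 t), fun a b => ?_⟩
  obtain ⟨C, hC⟩ := hf.2 a b
  obtain ⟨D, hD⟩ := hg.2 a b
  refine ⟨C + D, fun t ht x => ?_⟩
  rw [add_mul]
  exact (abs_add_le _ _).trans (add_le_add (hC t ht x) (hD t ht x))

theorem const_mul (hf : DecayingDensity f) (c : ℝ) : DecayingDensity fun t x => c * f t x := by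
  refine ⟨fun t => (hf.1 t).const_mul c, fun a b => ?_⟩
  obtain ⟨C, hC⟩ := hf.2 a b
  refine ⟨|c| * C, fun t ht x => ?_⟩
  rw [abs_mul, mul_assoc]
  exact mul_le_mul_of_nonneg_left (hC t ht x) (abs_nonneg c)

theorem neg (hf : DecayingDensity f) : DecayingDensity fun t x => -f t x := by
  simpa using hf.const_mul (-1)

theorem sub (hf : DecayingDensity f) (hg : DecayingDensity g) :
    DecayingDensity fun t x => f t x - g t x := by
  simpa only [sub_eq_add_neg] using hf.add hg.neg

theorem exists_convForm_bound {k : ℝ → ℝ} {K : ℝ} (hK : ∀ x, |k x| ≤ K)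
    (hf : DecayingDensity f) (hg : DecayingDensity g) (a b : ℝ) :
    ∃ C : ℝ, ∀ t ∈ Set.Icc a b, ∀ p : ℝ × ℝ,
      |f t p.1 * k (p.1 - p.2) * g t p.2| ≤
        C * ((1 + p.1 ^ 2)⁻¹ * (1 + p.2 ^ 2)⁻¹) := by
  obtain ⟨C, hC⟩ := hf.2 a b
  obtain ⟨D, hD⟩ := hg.2 a b
  refine ⟨C * K * D, fun t ht p => ?_⟩
  have hf0 := (abs_nonneg _).trans (hC t ht p.1)
  have hK0 := (abs_nonneg _).trans (hK (p.1 - p.2))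
  rw [abs_mul, abs_mul]
  calc |f t p.1| * |k (p.1 - p.2)| * |g t p.2|
      ≤ C * (1 + p.1 ^ 2)⁻¹ * K * (D * (1 + p.2 ^ 2)⁻¹) := by
        gcongr
        exacts [hC t ht p.1, hK _, hD t ht p.2]
    _ = C * K * D * ((1 + p.1 ^ 2)⁻¹ * (1 + p.2 ^ 2)⁻¹) := by ring

end DecayingDensity

theorem hasDerivAt_convForm {k : ℝ → ℝ} (hk : Continuous k) {K : ℝ} (hK : ∀ x, |k x| ≤ K)
    {f f' g g' : ℝ → ℝ → ℝ} (hf : DecayingDensity f) (hf' : DecayingDensity f')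
    (hg : DecayingDensity g) (hg' : DecayingDensity g')
    (hdf : ∀ t x, HasDerivAt (fun s => f s x) (f' t x) t)
    (hdg : ∀ t x, HasDerivAt (fun s => g s x) (g' t x) t) (t : ℝ) :
    HasDerivAt (fun s => convForm k (f s) (g s))
      (convForm k (f' t) (g t) + convForm k (f t) (g' t)) t := by
  obtain ⟨C, hC⟩ := hf'.exists_convForm_bound hK hg (t - 1) (t + 1)
  obtain ⟨D, hD⟩ := hf.exists_convForm_bound hK hg' (t - 1) (t + 1)
  have hi := integrable_convForm hk hK (hf'.integrable t) (hg.integrable t)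
  have hi' := integrable_convForm hk hK (hf.integrable t) (hg'.integrable t)
  rw [convForm_eq_integral_prod hk hK (hf'.integrable t) (hg.integrable t),
    convForm_eq_integral_prod hk hK (hf.integrable t) (hg'.integrable t), ← integral_add hi hi']
  simp only [fun s => convForm_eq_integral_prod hk hK (hf.integrable s) (hg.integrable s)]
  refine (hasDerivAt_integral_of_dominated_loc_of_deriv_le
    (F' := fun s (p : ℝ × ℝ) => f' s p.1 * k (p.1 - p.2) * g s p.2 +
      f s p.1 * k (p.1 - p.2) * g' s p.2)
    (bound := fun p => (C + D) * ((1 + p.1 ^ 2)⁻¹ * (1 + p.2 ^ 2)⁻¹))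
    (Icc_mem_nhds (sub_one_lt t) (lt_add_one t)) (Eventually.of_forall fun s =>
      (integrable_convForm hk hK (hf.integrable s) (hg.integrable s)).aestronglyMeasurable)
    (integrable_convForm hk hK (hf.integrable t) (hg.integrable t))
    (hi.add hi').aestronglyMeasurable (ae_of_all _ fun p s hs => ?_)
    ((integrable_inv_one_add_sq.mul_prod integrable_inv_one_add_sq).const_mul _)
    (ae_of_all _ fun p s _ => ((hdf s p.1).mul_const _).mul (hdg s p.2))).2
  rw [add_mul]
  exact (abs_add_le _ _).trans (add_le_add (hC s hs p) (hD s hs p))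

/-- Virial identity for the system of conservation laws `∂_t σ = -∂_x j`, `∂_t j = -∂_x P`. -/
theorem hasDerivAt_convForm_of_conservation_laws {k k' : ℝ → ℝ}
    (hk : ∀ x, HasDerivAt k (k' x) x) (hk' : Continuous k') {K K' : ℝ} (hK : ∀ x, |k x| ≤ K)
    (hK' : ∀ x, |k' x| ≤ K') {σ j j' P P' : ℝ → ℝ → ℝ} (hσ : DecayingDensity σ)
    (hj : DecayingDensity j) (hj' : DecayingDensity j') (hP : DecayingDensity P)
    (hP' : DecayingDensity P') (hσt : ∀ t x, HasDerivAt (fun s => σ s x) (-j' t x) t)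
    (hjx : ∀ t x, HasDerivAt (j t) (j' t x) x)
    (hjt : ∀ t x, HasDerivAt (fun s => j s x) (-P' t x) t)
    (hPx : ∀ t x, HasDerivAt (P t) (P' t x) x) (t : ℝ) :
    HasDerivAt (fun s => -convForm k (σ s) (j s))
      (convForm k' (σ t) (P t) - convForm k' (j t) (j t)) t := by
  have hkc : Continuous k := continuous_iff_continuousAt.2 fun x => (hk x).continuousAt
  refine (hasDerivAt_convForm hkc hK hσ hj'.neg hj hP'.neg hσt hjt t).neg.congr_deriv ?_
  have h1 : convForm k (fun x => -j' t x) (j t) = convForm k' (j t) (j t) := by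
    rw [convForm_deriv_left (f := fun x => -j t x) hk hk' hK hK' (fun x => (hjx t x).neg)
      (hj.integrable t).neg (hj'.integrable t).neg (hj.integrable t)]
    simp [convForm, integral_neg]
  have h2 : convForm k (σ t) (fun x => -P' t x) = -convForm k' (σ t) (P t) := by
    rw [convForm_deriv_right (g := fun x => -P t x) hk hk' hK hK' (fun x => (hPx t x).neg)
      (hP.integrable t).neg (hP'.integrable t).neg]
    simp [convForm, integral_neg]
  rw [h1, h2]
  ring

/-- Smooth in space-time and Schwartz in `x` with all derivatives, locally uniformly in `t`. -/
def SmoothDecaying1 (u : ℝ → ℝ → ℂ) : Prop :=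
  ContDiff ℝ (⊤ : ℕ∞) (fun p : ℝ × ℝ => u p.1 p.2) ∧ SchwartzDecay1 u

namespace SmoothDecaying1

variable {u v : ℝ → ℝ → ℂ}

theorem hasFDerivAt (hu : SmoothDecaying1 u) (p : ℝ × ℝ) :
    HasFDerivAt (fun p : ℝ × ℝ => u p.1 p.2) (fderiv ℝ (fun p : ℝ × ℝ => u p.1 p.2) p) p :=
  (hu.1.differentiable (by simp) p).hasFDerivAt

theorem hasDerivAt_fderiv_time (hu : SmoothDecaying1 u) (t x : ℝ) :
    HasDerivAt (fun s => u s x) (fderiv ℝ (fun p : ℝ × ℝ => u p.1 p.2) (t, x) (1, 0)) t :=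
  (hu.hasFDerivAt (t, x)).comp_hasDerivAt (f := fun s => (s, x)) t
    ((hasDerivAt_id t).prodMk (hasDerivAt_const t x))

theorem hasDerivAt_fderiv_space (hu : SmoothDecaying1 u) (t x : ℝ) :
    HasDerivAt (u t) (fderiv ℝ (fun p : ℝ × ℝ => u p.1 p.2) (t, x) (0, 1)) x :=
  (hu.hasFDerivAt (t, x)).comp_hasDerivAt (f := fun z => (t, z)) x
    ((hasDerivAt_const x t).prodMk (hasDerivAt_id x))

theorem dt1_eq (hu : SmoothDecaying1 u) :
    dt1 u = fun t x => fderiv ℝ (fun p : ℝ × ℝ => u p.1 p.2) (t, x) (1, 0) :=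
  funext₂ fun t x => (hu.hasDerivAt_fderiv_time t x).deriv

theorem dx1_eq (hu : SmoothDecaying1 u) :
    dx1 u = fun t x => fderiv ℝ (fun p : ℝ × ℝ => u p.1 p.2) (t, x) (0, 1) :=
  funext₂ fun t x => (hu.hasDerivAt_fderiv_space t x).deriv

theorem hasDerivAt_time (hu : SmoothDecaying1 u) (t x : ℝ) :
    HasDerivAt (fun s => u s x) (dt1 u t x) t := by
  rw [hu.dt1_eq]
  exact hu.hasDerivAt_fderiv_time t x

theorem hasDerivAt_space (hu : SmoothDecaying1 u) (t x : ℝ) :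
    HasDerivAt (u t) (dx1 u t x) x := by
  rw [hu.dx1_eq]
  exact hu.hasDerivAt_fderiv_space t x

theorem contDiff_fderiv (hu : SmoothDecaying1 u) :
    ContDiff ℝ (⊤ : ℕ∞) (fderiv ℝ fun p : ℝ × ℝ => u p.1 p.2) :=
  hu.1.fderiv_right (by simp)

theorem fderiv_apply (hu : SmoothDecaying1 u) (v : ℝ × ℝ) :
    SmoothDecaying1 fun t x => fderiv ℝ (fun p : ℝ × ℝ => u p.1 p.2) (t, x) v := by
  refine ⟨hu.contDiff_fderiv.clm_apply contDiff_const, fun N m a b => ?_⟩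
  obtain ⟨C, hC⟩ := hu.2 (N + 1) m a b
  refine ⟨‖v‖ * C, fun t ht x => ?_⟩
  have hN : ‖iteratedFDeriv ℝ N
      (fun p => fderiv ℝ (fun p : ℝ × ℝ => u p.1 p.2) p v) (t, x)‖ ≤ _ :=
    norm_iteratedFDeriv_clm_apply_const hu.contDiff_fderiv.contDiffAt
      (by exact_mod_cast le_top)
  rw [norm_iteratedFDeriv_fderiv] at hN
  calc _ ≤ (1 + |x|) ^ m * (‖v‖ *
        ‖iteratedFDeriv ℝ (N + 1) (fun p : ℝ × ℝ => u p.1 p.2) (t, x)‖) := by gcongr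
    _ = ‖v‖ * ((1 + |x|) ^ m *
        ‖iteratedFDeriv ℝ (N + 1) (fun p : ℝ × ℝ => u p.1 p.2) (t, x)‖) := by ring
    _ ≤ ‖v‖ * C := by gcongr; exact hC t ht x

theorem dt1 (hu : SmoothDecaying1 u) : SmoothDecaying1 (dt1 u) := by
  rw [hu.dt1_eq]
  exact hu.fderiv_apply _

theorem dx1 (hu : SmoothDecaying1 u) : SmoothDecaying1 (dx1 u) := by
  rw [hu.dx1_eq]
  exact hu.fderiv_apply _

theorem dt1_dx1_comm (hu : SmoothDecaying1 u) : _root_.dt1 (_root_.dx1 u) =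
    _root_.dx1 (_root_.dt1 u) := by
  have hd (p : ℝ × ℝ) := (hu.contDiff_fderiv.differentiable (by simp) p).hasFDerivAt
  have hd' (p v w : ℝ × ℝ) : fderiv ℝ
      (fun p => fderiv ℝ (fun p : ℝ × ℝ => u p.1 p.2) p v) p w =
      fderiv ℝ (fderiv ℝ fun p : ℝ × ℝ => u p.1 p.2) p w v := by
    rw [((hd p).clm_apply (hasFDerivAt_const v p)).fderiv]
    simp
  rw [hu.dx1.dt1_eq, hu.dt1.dx1_eq, hu.dx1_eq, hu.dt1_eq]
  funext t x
  have hs : IsSymmSndFDerivAt ℝ (fun p : ℝ × ℝ => u p.1 p.2) (t, x) :=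
    hu.1.contDiffAt.isSymmSndFDerivAt
      (by rw [minSmoothness_of_isRCLikeNormedField]; exact WithTop.coe_le_coe.2 le_top)
  exact (hd' _ _ _).trans ((hs.eq _ _).trans (hd' _ _ _).symm)

theorem exists_norm_bound (hu : SmoothDecaying1 u) (m : ℕ) (a b : ℝ) :
    ∃ C : ℝ, ∀ t ∈ Set.Icc a b, ∀ x : ℝ, (1 + |x|) ^ m * ‖u t x‖ ≤ C := by
  simpa using hu.2 0 m a b

theorem continuous_space (hu : SmoothDecaying1 u) (t : ℝ) : Continuous (u t) :=
  hu.1.continuous.comp (Continuous.prodMk_right t)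

theorem decayingDensity_inner (hu : SmoothDecaying1 u) (hv : SmoothDecaying1 v) :
    DecayingDensity fun t x => inner ℝ (u t x) (v t x) := by
  refine ⟨fun t => (hu.continuous_space t).inner (hv.continuous_space t), fun a b => ?_⟩
  obtain ⟨C, hC⟩ := hu.exists_norm_bound 1 a b
  obtain ⟨D, hD⟩ := hv.exists_norm_bound 1 a b
  refine ⟨C * D, fun t ht x => ?_⟩
  have hu' := hC t ht x
  have hv' := hD t ht x
  rw [← div_eq_mul_inv, le_div_iff₀ (by positivity)]
  calc |inner ℝ (u t x) (v t x)| * (1 + x ^ 2)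
      ≤ (‖u t x‖ * ‖v t x‖) * (1 + |x|) ^ 2 := by
        gcongr
        · exact abs_real_inner_le_norm _ _
        · rw [← sq_abs x]
          nlinarith [abs_nonneg x]
    _ = ((1 + |x|) ^ 1 * ‖u t x‖) * ((1 + |x|) ^ 1 * ‖v t x‖) := by ring
    _ ≤ C * D := mul_le_mul hu' hv' (by positivity) (le_trans (by positivity) hu')

theorem decayingDensity_norm_sq (hu : SmoothDecaying1 u) :
    DecayingDensity fun t x => ‖u t x‖ ^ 2 := by
  simpa only [real_inner_self_eq_norm_sq] using hu.decayingDensity_inner hu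

theorem decayingDensity_potential (hu : SmoothDecaying1 u) {g G : ℝ → ℝ} (hg : Continuous g)
    (hG : ∀ r, HasDerivAt G (g r) r) (hG0 : G 0 = 0) :
    DecayingDensity fun t x => G (‖u t x‖ ^ 2) := by
  have hGc : Continuous G := continuous_iff_continuousAt.2 fun r => (hG r).continuousAt
  refine ⟨fun t => hGc.comp ((hu.continuous_space t).norm.pow 2), fun a b => ?_⟩
  obtain ⟨C, hC⟩ := hu.exists_norm_bound 0 a b
  obtain ⟨D, hD⟩ := hu.decayingDensity_norm_sq.2 a b
  obtain ⟨K, hK⟩ := (isCompact_Icc (a := 0) (b := C ^ 2)).exists_bound_of_continuousOn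
    hg.continuousOn
  refine ⟨K * D, fun t ht x => ?_⟩
  have hut : ‖u t x‖ ≤ C := by simpa using hC t ht x
  have hsq : ‖u t x‖ ^ 2 ∈ Set.Icc 0 (C ^ 2) := ⟨by positivity, by gcongr⟩
  have hK0 : 0 ≤ K := (norm_nonneg _).trans (hK _ hsq)
  have hmv := (convex_Icc 0 (C ^ 2)).norm_image_sub_le_of_norm_hasDerivWithin_le
    (fun r _ => (hG r).hasDerivWithinAt) hK (Set.left_mem_Icc.2 (sq_nonneg C)) hsq
  rw [hG0, sub_zero, sub_zero, Real.norm_eq_abs, Real.norm_eq_abs] at hmv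
  rw [mul_assoc]
  exact hmv.trans (mul_le_mul_of_nonneg_left (hD t ht x) hK0)

end SmoothDecaying1

theorem nlkgMomentum_eq (u : ℝ → ℝ → ℂ) (t x : ℝ) :
    nlkgMomentum u t x = -2 * inner ℝ (dt1 u t x) (dx1 u t x) := by
  rw [nlkgMomentum, Complex.inner, mul_comm (dx1 u t x)]

/-- Flux of the momentum density, `|∂_t u|² + |∂_x u|² - G(|u|²)`. -/
def nlkgMomentumFlux (G : ℝ → ℝ) (u : ℝ → ℝ → ℂ) (t x : ℝ) : ℝ :=
  ‖dt1 u t x‖ ^ 2 + ‖dx1 u t x‖ ^ 2 - G (‖u t x‖ ^ 2)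

theorem nlkg_momentum_identity {g G : ℝ → ℝ} (hg : Continuous g)
    (hG : ∀ r, HasDerivAt G (g r) r) (hG0 : G 0 = 0) {k k' : ℝ → ℝ}
    (hk : ∀ x, HasDerivAt k (k' x) x) (hk' : Continuous k') {K K' : ℝ} (hK : ∀ x, |k x| ≤ K)
    (hK' : ∀ x, |k' x| ≤ K') {u : ℝ → ℝ → ℂ} (hu : IsNLKGSolution1 g u) (t : ℝ) :
    HasDerivAt (fun s => -convForm k (nlkgEnergy G u s) (nlkgMomentum u s))
      (convForm k' (nlkgEnergy G u t) (nlkgMomentumFlux G u t) -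
        convForm k' (nlkgMomentum u t) (nlkgMomentum u t)) t := by
  have hs : SmoothDecaying1 u := ⟨hu.1, hu.2.1⟩
  have heq (t x : ℝ) : dt1 (dt1 u) t x = dx1 (dx1 u) t x - g (‖u t x‖ ^ 2) • u t x := by
    have := hu.2.2 t x
    change dt1 (dt1 u) t x - dx1 (dx1 u) t x + _ = 0 at this
    rw [Complex.real_smul]
    linear_combination this
  have he := hs.dt1.decayingDensity_norm_sq.add hs.dx1.decayingDensity_norm_sq
  have hpot := hs.decayingDensity_potential hg hG hG0
  have hj : DecayingDensity (nlkgMomentum u) := by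
    convert (hs.dt1.decayingDensity_inner hs.dx1).const_mul (-2) using 3
    exact nlkgMomentum_eq u _ _
  have hj' := ((hs.dt1.decayingDensity_inner hs.dx1.dx1).add
    (hs.dt1.dx1.decayingDensity_inner hs.dx1)).const_mul (-2)
  have hP' := ((hs.dt1.decayingDensity_inner hs.dt1.dx1).add
    (hs.dt1.dt1.decayingDensity_inner hs.dx1)).const_mul 2
  refine hasDerivAt_convForm_of_conservation_laws hk hk' hK hK' (he.add hpot) hj hj'
    (he.sub hpot) hP' (fun t x => ?_) (fun t x => ?_) (fun t x => ?_) (fun t x => ?_) t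
  · refine (((hs.dt1.hasDerivAt_time t x).norm_sq.add (hs.dx1.hasDerivAt_time t x).norm_sq).add
      ((hG _).comp t (hs.hasDerivAt_time t x).norm_sq)).congr_deriv ?_
    rw [heq, hs.dt1_dx1_comm, inner_sub_right, real_inner_smul_right,
      real_inner_comm (u t x), real_inner_comm (dx1 u t x)]
    ring
  · refine HasDerivAt.congr_of_eventuallyEq ?_ (Eventually.of_forall (nlkgMomentum_eq u t))
    exact ((hs.dt1.hasDerivAt_space t x).inner ℝ (hs.dx1.hasDerivAt_space t x)).const_mul (-2)
  · refine HasDerivAt.congr_of_eventuallyEq ?_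
      (Eventually.of_forall fun s => nlkgMomentum_eq u s x)
    refine (((hs.dt1.hasDerivAt_time t x).inner ℝ
      (hs.dx1.hasDerivAt_time t x)).const_mul (-2)).congr_deriv ?_
    rw [hs.dt1_dx1_comm]
    ring
  · refine (((hs.dt1.hasDerivAt_space t x).norm_sq.add
      (hs.dx1.hasDerivAt_space t x).norm_sq).sub
      ((hG _).comp x (hs.hasDerivAt_space t x).norm_sq)).congr_deriv ?_
    rw [heq, inner_sub_left, real_inner_smul_left, real_inner_comm (dx1 u t x) (dx1 (dx1 u) t x)]
    ring

/-- Quadratic identity for the one-dimensional NLKG equation: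
with `M(t) = -∫∫ σ(t,x) h'(x-y) j(t,y) dx dy`,
`M'(t) = ∫∫ |∂_t u - ∂_x u|²(x) h''(x-y) |∂_t u + ∂_x u|²(y) - ∫∫ G h''(x-y) G`. -/
theorem nlkg_quadratic_identity_1d (g G : ℝ → ℝ) (hg : ContDiff ℝ (⊤ : ℕ∞) g)
    (hG : ∀ r : ℝ, G r = ∫ s in (0:ℝ)..r, g s)
    (h : ℝ → ℝ) (hsmooth : ContDiff ℝ (⊤ : ℕ∞) h) (heven : ∀ x, h (-x) = h x)
    (hbdd : ∀ i : ℕ, 1 ≤ i → ∃ C : ℝ, ∀ x, |iteratedDeriv i h x| ≤ C)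
    (u : ℝ → ℝ → ℂ) (hu : IsNLKGSolution1 g u) :
    ∀ t : ℝ, HasDerivAt
      (fun s => -∫ x : ℝ, ∫ y : ℝ, nlkgEnergy G u s x * deriv h (x - y) * nlkgMomentum u s y)
      ((∫ x : ℝ, ∫ y : ℝ, ‖dt1 u t x - dx1 u t x‖ ^ 2 * deriv (deriv h) (x - y)
          * ‖dt1 u t y + dx1 u t y‖ ^ 2)
        - ∫ x : ℝ, ∫ y : ℝ, G (‖u t x‖ ^ 2) * deriv (deriv h) (x - y) * G (‖u t y‖ ^ 2)) t := by
  intro t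
  have hgc : Continuous g := hg.continuous
  have hGd (r : ℝ) : HasDerivAt G (g r) r := by
    rw [funext hG]
    exact intervalIntegral.integral_hasDerivAt_right (hgc.intervalIntegrable _ _)
      hgc.aestronglyMeasurable.stronglyMeasurableAtFilter hgc.continuousAt
  have hG0 : G 0 = 0 := by simp [hG]
  have hh' : ContDiff ℝ (⊤ : ℕ∞) (deriv h) := (contDiff_infty_iff_deriv.1 hsmooth).2
  have hh'' : ContDiff ℝ (⊤ : ℕ∞) (deriv (deriv h)) := (contDiff_infty_iff_deriv.1 hh').2
  obtain ⟨K, hK⟩ := hbdd 1 le_rfl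
  obtain ⟨K', hK'⟩ := hbdd 2 one_le_two
  simp only [iteratedDeriv_succ, iteratedDeriv_zero] at hK hK'
  have hodd (x : ℝ) : deriv h (-x) = -deriv h x := by
    have := deriv_comp_neg h x
    rw [funext heven] at this
    rw [this, neg_neg]
  have heven' (x : ℝ) : deriv (deriv h) (-x) = deriv (deriv h) x := by
    have := deriv_comp_neg (deriv h) x
    simp only [hodd, deriv.fun_neg] at this
    exact neg_injective this.symm
  refine (nlkg_momentum_identity hgc hGd hG0
    (fun x => (hh'.differentiable (by simp) x).hasDerivAt) hh''.continuous hK hK' hu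
    t).congr_deriv ?_
  have hs : SmoothDecaying1 u := ⟨hu.1, hu.2.1⟩
  have he := (hs.dt1.decayingDensity_norm_sq.add hs.dx1.decayingDensity_norm_sq).integrable t
  have hpot := (hs.decayingDensity_potential hgc hGd hG0).integrable t
  have hj := ((hs.dt1.decayingDensity_inner hs.dx1).const_mul (-2)).integrable t
  have hflux := convForm_add_sub_of_even hh''.continuous hK' heven' he hpot
  have hnull := convForm_add_sub_of_even hh''.continuous hK' heven' he hj
  have hminus : (fun x => ‖dt1 u t x - dx1 u t x‖ ^ 2) = fun x =>
      ‖dt1 u t x‖ ^ 2 + ‖dx1 u t x‖ ^ 2 + -2 * inner ℝ (dt1 u t x) (dx1 u t x) := by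
    funext x
    rw [norm_sub_sq_real]
    ring
  have hplus : (fun x => ‖dt1 u t x + dx1 u t x‖ ^ 2) = fun x =>
      ‖dt1 u t x‖ ^ 2 + ‖dx1 u t x‖ ^ 2 - -2 * inner ℝ (dt1 u t x) (dx1 u t x) := by
    funext x
    rw [norm_add_sq_real]
    ring
  rw [← hminus, ← hplus] at hnull
  rw [← funext (nlkgMomentum_eq u t)] at hnull
  change convForm _ (nlkgEnergy G u t) (nlkgMomentumFlux G u t) = _ at hflux
  change _ = convForm (deriv (deriv h)) (fun x => ‖dt1 u t x - dx1 u t x‖ ^ 2)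
    (fun x => ‖dt1 u t x + dx1 u t x‖ ^ 2) -
    convForm (deriv (deriv h)) (fun x => G (‖u t x‖ ^ 2)) (fun x => G (‖u t x‖ ^ 2))
  rw [hflux, hnull]
  ring
end
end
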